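/- For Q an orientation of a Dynkin diagram, the Cambrian lattice C_Q — the lattice of torsion classes in rep Q ordered by inclusion — is trim, i.e., it is both left modular and extremal. Moreover, its join-irreducible elements are exactly the principal torsion classes Gen(M_α) for positive roots α, meets are given by intersection of torsion classes, and the splitting torsion classes form a maximal chain of left modular elements. -/

import Mathlib

open CategoryTheory CategoryTheory.Limits ZeroObject

attribute [local instance] CategoryTheory.Abelian.hasFiniteBiproducts

noncomputable section

namespace NCPaper

/-- A finite quiver without oriented cycles. -/
structure FinQuiver : Type 1 where
  V : Type
  [quiver : Quiver.{0} V]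
  [fintypeV : Fintype V]
  [fintypeArr : ∀ a b : V, Fintype (a ⟶ b)]
  acyclic : ∀ (v : V) (p : Quiver.Path v v), p = Quiver.Path.nil

attribute [instance] FinQuiver.quiver FinQuiver.fintypeV FinQuiver.fintypeArr

variable (k : Type) [Field k] (Q : FinQuiver)

/-- The ambient abelian category of all `k`-linear representations of `Q`;
finite-dimensional representations are singled out by the predicate `FinDim`. -/
abbrev RepC : Type 1 := Paths Q.V ⥤ ModuleCat.{0} k

variable {k Q}

/-- `M` is a finite-dimensional representation, i.e. an object of `rep Q`. -/
def FinDim (M : RepC k Q) : Prop :=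
  ∀ v : Q.V, FiniteDimensional k (M.obj ((Paths.of Q.V).obj v))

section Cat

variable {C : Type*} [Category C] [Abelian C]

/-- `X` is a direct summand of `A`. -/
def IsSummand (X A : C) : Prop := ∃ (i : X ⟶ A) (r : A ⟶ X), i ≫ r = 𝟙 X

/-- The additive closure of a set of objects: direct summands of finite direct sums. -/
def addSet (S : Set C) : Set C :=
  { X | ∃ (n : ℕ) (f : Fin n → C), (∀ i, f i ∈ S) ∧ IsSummand X (⨁ f) }

/-- `Gen S`: all quotients of objects of the additive closure of `S`. -/
def gen (S : Set C) : Set C := { X | ∃ A ∈ addSet S, ∃ p : A ⟶ X, Epi p }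

/-- All morphisms from `A` to `B` vanish. -/
def HomZero (A B : C) : Prop := ∀ f : A ⟶ B, f = 0

/-- `Ext¹(A, B) = 0`, expressed by the splitting of all short exact sequences
`0 ⟶ B ⟶ E ⟶ A ⟶ 0`. -/
def Ext1Zero (A B : C) : Prop :=
  ∀ (E : C) (i : B ⟶ E) (p : E ⟶ A) (w : i ≫ p = 0),
    (ShortComplex.mk i p w).ShortExact → ∃ r : E ⟶ B, i ≫ r = 𝟙 B

/-- An indecomposable object. -/
def Indec (X : C) : Prop :=
  ¬ IsZero X ∧ ∀ (A B : C), (X ≅ A ⊞ B) → IsZero A ∨ IsZero B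

/-- A torsion class: a full subcategory (identified with its set of objects) closed under
direct sums, direct summands, quotients and extensions. -/
structure IsTorsionClass (T : Set C) : Prop where
  zero_mem : (0 : C) ∈ T
  sum_mem : ∀ X ∈ T, ∀ Y ∈ T, (X ⊞ Y : C) ∈ T
  summand_mem : ∀ X ∈ T, ∀ Y : C, IsSummand Y X → Y ∈ T
  quot_mem : ∀ X ∈ T, ∀ (Y : C) (p : X ⟶ Y), Epi p → Y ∈ T
  ext_mem : ∀ S : ShortComplex C, S.ShortExact → S.X₁ ∈ T → S.X₃ ∈ T → S.X₂ ∈ T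

/-- A wide subcategory: a full subcategory (closed under direct sums and summands)
which is exact abelian (closed under kernels and cokernels) and closed under extensions. -/
structure IsWide (A : Set C) : Prop where
  zero_mem : (0 : C) ∈ A
  sum_mem : ∀ X ∈ A, ∀ Y ∈ A, (X ⊞ Y : C) ∈ A
  summand_mem : ∀ X ∈ A, ∀ Y : C, IsSummand Y X → Y ∈ A
  ker_mem : ∀ X ∈ A, ∀ Y ∈ A, ∀ f : X ⟶ Y, (kernel f : C) ∈ A
  coker_mem : ∀ X ∈ A, ∀ Y ∈ A, ∀ f : X ⟶ Y, (cokernel f : C) ∈ A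
  ext_mem : ∀ S : ShortComplex C, S.ShortExact → S.X₁ ∈ A → S.X₃ ∈ A → S.X₂ ∈ A

/-- `P` is split projective in the subcategory `T`: every epimorphism onto `P`
from an object of `T` splits. -/
def SplitProjIn (T : Set C) (P : C) : Prop :=
  P ∈ T ∧ ∀ X ∈ T, ∀ p : X ⟶ P, Epi p → ∃ s : P ⟶ X, s ≫ p = 𝟙 P

/-- `P` is Ext-projective in the subcategory `T`. -/
def ExtProjIn (T : Set C) (P : C) : Prop := P ∈ T ∧ ∀ X ∈ T, Ext1Zero P X

/-- The subcategory `a(T)` associated to a torsion class `T`. -/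
def aSet (T : Set C) : Set C :=
  { B | B ∈ T ∧ ∀ Y ∈ T, ∀ g : Y ⟶ B, (kernel g : C) ∈ T }

/-- A subcategory is finitely generated if it is generated by a single object of it. -/
def IsFinGen (T : Set C) : Prop := ∃ U ∈ T, T ⊆ gen {U}

/-- `U` is a generator of the subcategory `T`. -/
def IsGenerator (T : Set C) (U : C) : Prop := U ∈ T ∧ T ⊆ gen {U}

/-- `X` is a subquotient of `M`. -/
def IsSubquotient (X M : C) : Prop := ∃ (N : C) (i : N ⟶ M) (p : N ⟶ X), Mono i ∧ Epi p

/-- The support of `M` is contained in the support of `C0`: every simple subquotient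
(composition factor) of `M` is a composition factor of `C0`. -/
def SuppLE (M C0 : C) : Prop := ∀ S : C, Simple S → IsSubquotient S M → IsSubquotient S C0

/-- A partial tilting object of a hereditary category. -/
def IsPartialTilting (T : C) : Prop := Ext1Zero T T

/-- `T` is a tilting object of the full subcategory `A`: it is self-orthogonal and every
(split) projective object of `A` admits a coresolution `0 ⟶ P ⟶ T' ⟶ T'' ⟶ 0` with
`T', T'' ∈ add T`. For `A` the subcategory of representations supported on `supp T`,
this says exactly that `T` is a tilting `kQ/ann T`-module. -/
def TiltingIn (A : Set C) (T : C) : Prop :=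
  T ∈ A ∧ Ext1Zero T T ∧
    ∀ P : C, SplitProjIn A P →
      ∃ (T' T'' : C) (_ : T' ∈ addSet {T}) (_ : T'' ∈ addSet {T})
        (i : P ⟶ T') (p : T' ⟶ T'') (w : i ≫ p = 0),
        (ShortComplex.mk i p w).ShortExact


/-- `U` is the direct sum of one representative of each isomorphism class of
indecomposable Ext-projective objects of `T`. -/
def IsExtProjSum (T : Set C) (U : C) : Prop :=
  ∃ (n : ℕ) (f : Fin n → C),
    (∀ i, Indec (f i) ∧ ExtProjIn T (f i)) ∧
    (∀ i j, Nonempty (f i ≅ f j) → i = j) ∧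
    (∀ P : C, Indec P → ExtProjIn T P → ∃ i, Nonempty (P ≅ f i)) ∧
    Nonempty (U ≅ ⨁ f)

/-- A basic object: a direct sum of pairwise non-isomorphic indecomposables. -/
def IsBasic (U : C) : Prop :=
  ∃ (n : ℕ) (f : Fin n → C), (∀ i, Indec (f i)) ∧
    (∀ i j, Nonempty (f i ≅ f j) → i = j) ∧ Nonempty (U ≅ ⨁ f)

end Cat

/-- A support tilting object of `rep Q`: partial tilting, and tilting as a
`kQ/ann T`-module, i.e. tilting in the subcategory of all finite-dimensional
representations supported on the support of `T`. -/
def IsSupportTilting {k : Type} [Field k] {Q : FinQuiver} (T : RepC k Q) : Prop :=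
  IsPartialTilting T ∧ TiltingIn { M : RepC k Q | FinDim M ∧ SuppLE M T } T

section Comb

/-- The dimension vector of a representation. -/
def dimVec {k : Type} [Field k] {Q : FinQuiver} (M : RepC k Q) : Q.V → ℤ :=
  fun v => (Module.finrank k (M.obj ((Paths.of Q.V).obj v)) : ℤ)

/-- The Euler form of the quiver `Q`. -/
def euler (Q : FinQuiver) {R : Type} [CommRing R] (α β : Q.V → R) : R :=
  (∑ v : Q.V, α v * β v) - ∑ a : (Σ x : Q.V, Σ y : Q.V, x ⟶ y), α a.1 * β a.2.1

/-- The symmetrized Euler form of the quiver `Q`. -/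
def symEuler (Q : FinQuiver) {R : Type} [CommRing R] (α β : Q.V → R) : R :=
  euler Q α β + euler Q β α

/-- The reflection in the vector `v`: `s_v(w) = w - (v, w)·v`. -/
def reflV (Q : FinQuiver) (v : Q.V → ℤ) : (Q.V → ℤ) → (Q.V → ℤ) :=
  fun w => w - symEuler Q v w • v

/-- The composition (product, written from left to right) of a finite sequence of
linear transformations. -/
def comps (Q : FinQuiver) {m : ℕ} (g : Fin m → ((Q.V → ℤ) → (Q.V → ℤ))) :
    (Q.V → ℤ) → (Q.V → ℤ) :=
  (List.ofFn g).foldr (· ∘ ·) id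

open scoped Classical in
/-- The simple root at a vertex. -/
def simRoot (Q : FinQuiver) (v : Q.V) : Q.V → ℤ := fun w => if w = v then 1 else 0

/-- The simple reflection at a vertex. -/
def sref (Q : FinQuiver) (v : Q.V) : (Q.V → ℤ) → (Q.V → ℤ) := reflV Q (simRoot Q v)

/-- An enumeration of the vertices is compatible with the arrows of `Q` if sources
of arrows come before targets. -/
def OrdCompatible (Q : FinQuiver) (ord : Fin (Fintype.card Q.V) ≃ Q.V) : Prop :=
  ∀ (x y : Q.V), (x ⟶ y) → ord.symm x < ord.symm y

/-- The Coxeter element `cox(Q)`: the product of the simple reflections from left to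
right in an order compatible with the arrows of `Q`. -/
def coxeter (Q : FinQuiver) (ord : Fin (Fintype.card Q.V) ≃ Q.V) :
    (Q.V → ℤ) → (Q.V → ℤ) :=
  comps Q fun i => sref Q (ord i)

/-- The product of the simple reflections indexed by a word (a list of vertices). -/
def wordProd (Q : FinQuiver) (l : List Q.V) : (Q.V → ℤ) → (Q.V → ℤ) :=
  (l.map (sref Q)).foldr (· ∘ ·) id

/-- Membership in the Coxeter group `W` (realized faithfully on the root lattice). -/
def InW (Q : FinQuiver) (w : (Q.V → ℤ) → (Q.V → ℤ)) : Prop :=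
  ∃ l : List Q.V, w = wordProd Q l

/-- The reflections of `W`: the conjugates of the simple reflections. -/
def IsRefl (Q : FinQuiver) (t : (Q.V → ℤ) → (Q.V → ℤ)) : Prop :=
  ∃ (l : List Q.V) (i : Q.V), t = wordProd Q l ∘ sref Q i ∘ wordProd Q l.reverse

/-- The absolute length: the least length of an expression as a product of reflections. -/
def ellT (Q : FinQuiver) (w : (Q.V → ℤ) → (Q.V → ℤ)) : ℕ :=
  sInf { m | ∃ f : Fin m → ((Q.V → ℤ) → (Q.V → ℤ)), (∀ i, IsRefl Q (f i)) ∧ w = comps Q f }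

/-- The absolute order on `W`. -/
def absLe (Q : FinQuiver) : ((Q.V → ℤ) → (Q.V → ℤ)) → ((Q.V → ℤ) → (Q.V → ℤ)) → Prop :=
  Relation.ReflTransGen fun u v => ∃ t, IsRefl Q t ∧ v = u ∘ t ∧ ellT Q v = ellT Q u + 1

/-- The noncrossing partitions `NC_Q`: the interval `[e, cox(Q)]` in absolute order. -/
def NCSet (Q : FinQuiver) (ord : Fin (Fintype.card Q.V) ≃ Q.V) :
    Set ((Q.V → ℤ) → (Q.V → ℤ)) :=
  { w | InW Q w ∧ absLe Q w (coxeter Q ord) }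

/-- `Q` is of finite (Dynkin) type: the symmetrized Euler form is positive definite. -/
def FiniteType (Q : FinQuiver) : Prop :=
  ∀ α : Q.V → ℚ, α ≠ 0 → 0 < symEuler Q α α

/-- `Q` is of affine (extended Dynkin) type: the symmetrized Euler form is positive
semidefinite with nontrivial radical. -/
def AffineType (Q : FinQuiver) : Prop :=
  (∀ α : Q.V → ℚ, 0 ≤ symEuler Q α α) ∧ ∃ α : Q.V → ℚ, α ≠ 0 ∧ symEuler Q α α = 0

end Comb

section Statement19

variable {k : Type} [Field k] {Q : FinQuiver}

/-- A torsion class of `rep Q` (a torsion class consisting of finite-dimensional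
representations). -/
def Tors (T : Set (RepC k Q)) : Prop := IsTorsionClass T ∧ ∀ X ∈ T, FinDim X

variable (k Q)

/-- The join of two torsion classes in the lattice of torsion classes: the smallest
torsion class containing both. -/
def tjoin (T₁ T₂ : Set (RepC k Q)) : Set (RepC k Q) :=
  ⋂₀ { U : Set (RepC k Q) | Tors U ∧ T₁ ⊆ U ∧ T₂ ⊆ U }

variable {k Q}

/-- A join-irreducible element of the lattice of torsion classes. -/
def JoinIrred (T : Set (RepC k Q)) : Prop :=
  Tors T ∧ (∃ X ∈ T, ¬ IsZero X) ∧
    ∀ T₁ T₂ : Set (RepC k Q), Tors T₁ → Tors T₂ → T = tjoin k Q T₁ T₂ →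
      T = T₁ ∨ T = T₂

/-- A meet-irreducible element of the lattice of torsion classes. -/
def MeetIrred (T : Set (RepC k Q)) : Prop :=
  Tors T ∧ (∃ X : RepC k Q, FinDim X ∧ X ∉ T) ∧
    ∀ T₁ T₂ : Set (RepC k Q), Tors T₁ → Tors T₂ → T = T₁ ∩ T₂ → T = T₁ ∨ T = T₂

/-- A left modular element of the lattice of torsion classes:
`(y ∨ x) ∧ z = y ∨ (x ∧ z)` whenever `y ⊆ z`.  (Meets of torsion classes are
intersections.) -/
def LeftModular (x : Set (RepC k Q)) : Prop :=
  Tors x ∧ ∀ y z : Set (RepC k Q), Tors y → Tors z → y ⊆ z →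
    tjoin k Q y x ∩ z = tjoin k Q y (x ∩ z)

/-- A splitting torsion class: every indecomposable is torsion or torsion free. -/
def Splitting (T : Set (RepC k Q)) : Prop :=
  Tors T ∧ ∀ M : RepC k Q, FinDim M → Indec M → (M ∈ T ∨ ∀ Y ∈ T, HomZero Y M)

/-- A strictly increasing chain of torsion classes of length `N`. -/
def TorsChain (N : ℕ) (c : Fin (N + 1) → Set (RepC k Q)) : Prop :=
  (∀ i, Tors (c i)) ∧ ∀ i j : Fin (N + 1), i < j → c i ⊂ c j

/-- A maximal (unrefinable) chain in the lattice of torsion classes, from the zero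
torsion class to all of `rep Q`. -/
def MaxTorsChain (N : ℕ) (c : Fin (N + 1) → Set (RepC k Q)) : Prop :=
  TorsChain N c ∧ c 0 = { X : RepC k Q | IsZero X } ∧
    c (Fin.last N) = { X : RepC k Q | FinDim X } ∧
    ∀ (i : Fin N) (T : Set (RepC k Q)), Tors T →
      c i.castSucc ⊆ T → T ⊆ c i.succ → T = c i.castSucc ∨ T = c i.succ


noncomputable section Num
variable {V : Type}

/-- Euler form attached to a list of vertices (sinks first). -/
def lform (a : V → V → ℤ) : List V → (V → ℤ) → (V → ℤ) → ℤ
  | [], _, _ => 0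
  | i :: L, x, y => x i * y i + (L.map fun j => a i j * x j).sum * y i + lform a L x y

open scoped Classical in
def lref (a : V → V → ℤ) (i : V) (L : List V) (x : V → ℤ) : V → ℤ :=
  fun v => if v = i then - x i - (L.map fun j => a i j * x j).sum else x v

lemma lform_congr (a : V → V → ℤ) (L : List V) (x y x' y' : V → ℤ)
    (hx : ∀ v ∈ L, x v = x' v) (hy : ∀ v ∈ L, y v = y' v) :
    lform a L x y = lform a L x' y' := by
  induction L with
  | nil => rfl
  | cons i L ih =>
    have h1 : (L.map fun j => a i j * x j) = (L.map fun j => a i j * x' j) := by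
      apply List.map_congr_left
      intro j hj
      rw [hx j (by simp [hj])]
    simp only [lform]
    rw [h1, hx i (by simp), hy i (by simp),
      ih (fun v hv => hx v (by simp [hv])) (fun v hv => hy v (by simp [hv]))]

lemma sum_map_congr (a : V → V → ℤ) (i : V) (L : List V) (x x' : V → ℤ)
    (hx : ∀ v ∈ L, x v = x' v) :
    (L.map fun j => a i j * x j).sum = (L.map fun j => a i j * x' j).sum := by
  congr 1
  apply List.map_congr_left
  intro j hj
  rw [hx j hj]

lemma lform_append (a : V → V → ℤ) (ha : ∀ i j, a i j = a j i) (L : List V) (i : V)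
    (x y : V → ℤ) :
    lform a (L ++ [i]) x y
      = lform a L x y + x i * y i + x i * (L.map fun j => a i j * y j).sum := by
  induction L with
  | nil => simp [lform]
  | cons j L ih =>
    simp only [List.cons_append, lform, ih, List.map_append, List.sum_append, List.map_cons,
      List.sum_cons, List.map_nil, List.sum_nil, ha i j]
    ring

lemma lref_same (a : V → V → ℤ) (i : V) (L : List V) (x : V → ℤ) :
    lref a i L x i = - x i - (L.map fun j => a i j * x j).sum := by simp [lref]

lemma lref_ne (a : V → V → ℤ) (i : V) (L : List V) (x : V → ℤ) {v : V} (h : v ≠ i) :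
    lref a i L x v = x v := by simp [lref, h]

lemma lform_ref (a : V → V → ℤ) (ha : ∀ i j, a i j = a j i) (L : List V) (i : V)
    (hi : i ∉ L) (x y : V → ℤ) :
    lform a (L ++ [i]) (lref a i L x) (lref a i L y) = lform a (i :: L) x y := by
  have hne : ∀ v ∈ L, v ≠ i := fun v hv h => hi (h ▸ hv)
  rw [lform_append a ha, lref_same, lref_same,
    lform_congr a L (lref a i L x) (lref a i L y) x y
      (fun v hv => lref_ne _ _ _ _ (hne v hv)) (fun v hv => lref_ne _ _ _ _ (hne v hv)),
    sum_map_congr a i L (lref a i L y) y (fun v hv => lref_ne _ _ _ _ (hne v hv))]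
  simp only [lform]
  ring

lemma lform_rot (a : V → V → ℤ) (ha : ∀ i j, a i j = a j i) (L : List V) (i : V)
    (x : V → ℤ) : lform a (L ++ [i]) x x = lform a (i :: L) x x := by
  rw [lform_append a ha]; simp only [lform]; ring

lemma sum_map_add (a : V → V → ℤ) (i : V) (L : List V) (x x' : V → ℤ) :
    (L.map fun j => a i j * (x j + x' j)).sum
      = (L.map fun j => a i j * x j).sum + (L.map fun j => a i j * x' j).sum := by
  induction L with
  | nil => simp
  | cons j L ih => simp only [List.map_cons, List.sum_cons, ih, Pi.add_apply]; ring

lemma sum_map_neg (a : V → V → ℤ) (i : V) (L : List V) (x : V → ℤ) :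
    (L.map fun j => a i j * -(x j)).sum = -(L.map fun j => a i j * x j).sum := by
  induction L with
  | nil => simp
  | cons j L ih => simp only [List.map_cons, List.sum_cons, ih, Pi.neg_apply]; ring

lemma lform_sub (a : V → V → ℤ) (L : List V) (x y : V → ℤ) :
    lform a L (x - y) (x - y)
      = lform a L x x + lform a L y y - lform a L x y - lform a L y x := by
  induction L with
  | nil => simp [lform]
  | cons i L ih =>
    rw [sub_eq_add_neg] at ih ⊢
    simp only [lform, ih, sum_map_add, sum_map_neg, Pi.add_apply, Pi.neg_apply]
    ring

lemma sum_map_nonpos (a : V → V → ℤ) (i : V) (L : List V) (hL : ∀ j ∈ L, a i j ≤ 0)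
    (x : V → ℤ) (hx : ∀ v, 0 ≤ x v) : (L.map fun j => a i j * x j).sum ≤ 0 := by
  induction L with
  | nil => simp
  | cons j L ih =>
    simp only [List.map_cons, List.sum_cons]
    have := ih (fun j hj => hL j (by simp [hj]))
    have h2 := hL j (by simp)
    nlinarith [hx j]

lemma lform_nonpos (a : V → V → ℤ) (ha : ∀ i j, i ≠ j → a i j ≤ 0) (L : List V)
    (hL : L.Nodup) (x y : V → ℤ) (hx : ∀ v, 0 ≤ x v) (hy : ∀ v, 0 ≤ y v)
    (hxy : ∀ v, x v * y v = 0) : lform a L x y ≤ 0 := by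
  induction L with
  | nil => simp [lform]
  | cons i L ih =>
    rw [List.nodup_cons] at hL
    have h1 := ih hL.2
    have h2 := sum_map_nonpos a i L (fun j hj => ha i j (fun h => hL.1 (h ▸ hj))) x hx
    simp only [lform, hxy]
    nlinarith [hy i]

/-- positive roots -/
def PRoot (a : V → V → ℤ) (L : List V) (x : V → ℤ) : Prop :=
  (∀ v, 0 ≤ x v) ∧ lform a L x x = 1

open scoped Classical in
def ee (i : V) : V → ℤ := fun v => if v = i then 1 else 0

/-- the standing hypotheses on the list -/
structure Good (a : V → V → ℤ) (L : List V) : Prop where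
  symm : ∀ i j, a i j = a j i
  nonpos : ∀ i j, i ≠ j → a i j ≤ 0
  nodup : L.Nodup
  full : ∀ v, v ∈ L
  pos : ∀ x : V → ℤ, x ≠ 0 → 1 ≤ lform a L x x

lemma Good.rot {a : V → V → ℤ} {i : V} {L : List V} (h : Good a (i :: L)) :
    Good a (L ++ [i]) where
  symm := h.symm
  nonpos := h.nonpos
  nodup := by
    have := h.nodup
    rw [List.nodup_append_comm]; simpa using this
  full v := by have := h.full v; simp at this ⊢; tauto
  pos x hx := by rw [lform_rot a h.symm]; exact h.pos x hx

lemma lform_ee_right {a : V → V → ℤ} {i : V} {L : List V} (h : i ∉ L) (x : V → ℤ) :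
    lform a L x (ee i) = 0 := by
  induction L with
  | nil => rfl
  | cons j L ih =>
    simp only [List.mem_cons, not_or] at h
    have : ee i j = 0 := by simp [ee, Ne.symm h.1]
    simp [lform, ih h.2, this]

lemma lform_ee_left {a : V → V → ℤ} {i : V} {L : List V} (h : i ∉ L) (x : V → ℤ) :
    lform a L (ee i) x = 0 := by
  rw [lform_congr a L (ee i) x 0 x]
  · clear h
    induction L with
    | nil => rfl
    | cons j L ih => simp [lform, ih]
  · intro v hv
    have : v ≠ i := fun e => h (e ▸ hv)
    simp [ee, this]
  · simp

lemma Good.q_ee {a : V → V → ℤ} {i : V} {L : List V} (h : Good a (i :: L)) :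
    lform a (i :: L) (ee i) (ee i) = 1 := by
  have hi := (List.nodup_cons.1 h.nodup).1
  have h2 : (L.map fun j => a i j * ee i j).sum = 0 := by
    rw [sum_map_congr a i L (ee i) 0]
    · simp
    · intro v hv
      have : v ≠ i := fun e => hi (e ▸ hv)
      simp [ee, this]
  simp only [lform, h2, lform_ee_left hi]
  simp [ee]

lemma Good.sink {a : V → V → ℤ} {i : V} {L : List V} (h : Good a (i :: L)) {x : V → ℤ}
    (hx : PRoot a (i :: L) x) (h1 : 1 ≤ lform a (i :: L) x (ee i)) : x = ee i := by
  by_contra hne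
  have hi := (List.nodup_cons.1 h.nodup).1
  have hp := h.pos (x - ee i) (sub_ne_zero.2 hne)
  rw [lform_sub, h.q_ee, hx.2] at hp
  have e1 : lform a (i :: L) (ee i) x = x i := by
    have h2 : (L.map fun j => a i j * ee i j).sum = 0 := by
      rw [sum_map_congr a i L (ee i) 0]
      · simp
      · intro v hv
        have : v ≠ i := fun e => hi (e ▸ hv)
        simp [ee, this]
    simp only [lform, h2, lform_ee_left hi]
    simp [ee]
  have e2 : lform a (i :: L) x (ee i) = x i + (L.map fun j => a i j * x j).sum := by
    simp only [lform, lform_ee_right hi]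
    simp [ee]
  have h3 := sum_map_nonpos a i L (fun j hj => h.nonpos i j (fun e => hi (e ▸ hj))) x hx.1
  have := hx.1 i
  omega

lemma Good.ref {a : V → V → ℤ} {i : V} {L : List V} (h : Good a (i :: L)) {x : V → ℤ}
    (hx : PRoot a (i :: L) x) (hne : x ≠ ee i) : PRoot a (L ++ [i]) (lref a i L x) := by
  have hi := (List.nodup_cons.1 h.nodup).1
  have hq : lform a (L ++ [i]) (lref a i L x) (lref a i L x) = 1 := by
    rw [lform_ref a h.symm L i hi]; exact hx.2
  refine ⟨?_, hq⟩
  have hg := h.rot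
  set y := lref a i L x with hy
  -- split in positive and negative parts
  by_contra hcon
  push Not at hcon
  obtain ⟨w, hw⟩ := hcon
  have hwi : w = i := by
    by_contra hwi
    rw [hy, lref_ne _ _ _ _ hwi] at hw
    exact absurd (hx.1 w) (by omega)
  subst hwi
  have hex : ∃ v, v ≠ w ∧ x v ≠ 0 := by
    by_contra hall
    push Not at hall
    have hxe : x = fun v => x w * ee w v := by
      funext v
      by_cases hv : v = w
      · subst hv; simp [ee]
      · simp [ee, hv, hall v hv]
    have h2 : (L.map fun j => a w j * x j).sum = 0 := by
      rw [sum_map_congr a w L x 0]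
      · simp
      · intro v hv
        exact hall v (fun e => hi (e ▸ hv))
    have h3 : lform a L x x = 0 := by
      rw [lform_congr a L x x 0 x]
      · clear * -
        induction L with
        | nil => rfl
        | cons j L ih => simp [lform, ih]
      · intro v hv; exact hall v (fun e => hi (e ▸ hv))
      · simp
    have h4 := hx.2
    simp only [lform, h2, h3] at h4
    have h5 : x w = 1 := by
      have := hx.1 w
      nlinarith
    apply hne
    rw [hxe, h5]; simp
  obtain ⟨v, hvw, hv⟩ := hex
  set yp : V → ℤ := fun u => max (y u) 0
  set yn : V → ℤ := fun u => max (-(y u)) 0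
  have e : y = yp - yn := by
    funext u; simp only [yp, yn, Pi.sub_apply]; omega
  have hpn : ∀ u, yp u * yn u = 0 := by
    intro u
    simp only [yp, yn]
    rcases le_total (y u) 0 with h | h
    · rw [max_eq_right h]; simp
    · rw [max_eq_right (a := -(y u)) (by omega)]; simp
  have h1 := lform_nonpos a hg.nonpos _ hg.nodup yp yn (by intro u; simp [yp])
    (by intro u; simp [yn]) hpn
  have h2 := lform_nonpos a hg.nonpos _ hg.nodup yn yp (by intro u; simp [yn])
    (by intro u; simp [yp]) (by intro u; rw [mul_comm]; exact hpn u)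
  have h3 := hg.pos yp (by
    intro h0
    have := congrFun h0 v
    simp only [yp, hy, lref_ne _ _ _ _ hvw, Pi.zero_apply] at this
    have := hx.1 v
    omega)
  have h4 := hg.pos yn (by
    intro h0
    have := congrFun h0 w
    simp only [yn, Pi.zero_apply] at this
    omega)
  rw [e, lform_sub] at hq
  omega

/-- `x` dies after exactly `m` reflections. -/
def Dies (a : V → V → ℤ) : ℕ → List V → (V → ℤ) → Prop
  | _, [], _ => False
  | 0, i :: _, x => x = ee i
  | m + 1, i :: L, x => x ≠ ee i ∧ Dies a m (L ++ [i]) (lref a i L x)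

lemma dies_mono {a : V → V → ℤ} (m' : ℕ) : ∀ (m : ℕ) (L : List V) (_ : Good a L) (x y : V → ℤ),
    PRoot a L x → PRoot a L y → Dies a m L x → Dies a m' L y → 1 ≤ lform a L x y → m ≤ m' := by
  induction m' with
  | zero =>
    intro m L hL x y hx hy hm hm' h1
    match L, m, hm, hm' with
    | i :: L, 0, _, _ => exact le_rfl
    | i :: L, m + 1, hm, hm' =>
      change y = ee i at hm'
      subst hm'
      exact absurd (hL.sink hx h1) hm.1
  | succ m' ih =>
    intro m L hL x y hx hy hm hm' h1
    match L, m, hm, hm' with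
    | i :: L, 0, _, _ => exact Nat.zero_le _
    | i :: L, m + 1, hm, hm' =>
      have := ih m (L ++ [i]) hL.rot _ _ (hL.ref hx hm.1) (hL.ref hy hm'.1) hm.2 hm'.2 (by
        rwa [lform_ref a hL.symm L i (List.nodup_cons.1 hL.nodup).1])
      omega

lemma lref_inj {a : V → V → ℤ} {i : V} {L : List V} (hi : i ∉ L) {x y : V → ℤ}
    (h : lref a i L x = lref a i L y) : x = y := by
  have h1 : ∀ v, v ≠ i → x v = y v := by
    intro v hv
    have := congrFun h v
    rwa [lref_ne _ _ _ _ hv, lref_ne _ _ _ _ hv] at this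
  funext v
  by_cases hv : v = i
  · subst hv
    have := congrFun h v
    rw [lref_same, lref_same, sum_map_congr a v L x y
      (fun w hw => h1 w (fun e => hi (e ▸ hw)))] at this
    omega
  · exact h1 v hv

lemma dies_inj {a : V → V → ℤ} (m : ℕ) : ∀ (L : List V) (_ : Good a L) (x y : V → ℤ),
    Dies a m L x → Dies a m L y → x = y := by
  induction m with
  | zero =>
    intro L hL x y hx hy
    match L, hx, hy with
    | i :: L, hx, hy => exact Eq.trans hx (Eq.symm hy)
  | succ m ih =>
    intro L hL x y hx hy
    match L, hx, hy with
    | i :: L, hx, hy =>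
      exact lref_inj (List.nodup_cons.1 hL.nodup).1 (ih _ hL.rot _ _ hx.2 hy.2)

/-- reflecting successively: the first list is still to be done, the second already done. -/
def lfold (a : V → V → ℤ) : List V → List V → (V → ℤ) → (V → ℤ)
  | [], _, x => x
  | i :: L, M, x => lfold a L (M ++ [i]) (lref a i (L ++ M) x)

lemma nostop_fold {a : V → V → ℤ} (L : List V) : ∀ (M : List V) (_ : Good a (L ++ M)) (x : V → ℤ),
    PRoot a (L ++ M) x → (¬ ∃ m, Dies a m (L ++ M) x) →
    PRoot a (M ++ L) (lfold a L M x) ∧ ¬ ∃ m, Dies a m (M ++ L) (lfold a L M x) := by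
  induction L with
  | nil => intro M _ x hx h; exact ⟨by simpa [lfold] using hx, by simpa [lfold] using h⟩
  | cons i L ih =>
    intro M hg x hx h
    have hne : x ≠ ee i := fun e => h ⟨0, e⟩
    have := ih (M ++ [i]) (by simpa using hg.rot) (lref a i (L ++ M) x)
      (by simpa using hg.ref hx hne)
      (by
        rintro ⟨m, hm⟩
        exact h ⟨m + 1, hne, by simpa using hm⟩)
    simpa [lfold] using this

lemma lfold_add (a : V → V → ℤ) (L : List V) : ∀ (M : List V) (x y : V → ℤ),
    lfold a L M (x + y) = lfold a L M x + lfold a L M y := by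
  induction L with
  | nil => intros; rfl
  | cons i L ih =>
    intro M x y
    simp only [lfold]
    rw [← ih]
    congr 1
    funext v
    simp only [Pi.add_apply]
    by_cases hv : v = i
    · subst hv; simp only [lref_same, sum_map_add, Pi.add_apply]; ring
    · simp [lref_ne _ _ _ _ hv]

lemma lfold_ne (a : V → V → ℤ) (L : List V) : ∀ (M : List V) (x : V → ℤ) (v : V), v ∉ L →
    lfold a L M x v = x v := by
  induction L with
  | nil => intros; rfl
  | cons i L ih =>
    intro M x v hv
    simp only [List.mem_cons, not_or] at hv
    simp only [lfold]
    rw [ih _ _ _ hv.2, lref_ne _ _ _ _ hv.1]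

lemma lfold_fix [DecidableEq V] {a : V → V → ℤ} (L : List V) : ∀ (M : List V) (_ : (L ++ M).Nodup) (x : V → ℤ),
    lfold a L M x = x →
    ∀ i ∈ L, 2 * x i + (((L ++ M).filter fun j => j ≠ i).map fun j => a i j * x j).sum = 0 := by
  induction L with
  | nil => intro M _ x _ i hi; simp at hi
  | cons i L ih =>
    intro M hnd x hfix
    have hi : i ∉ L ++ M := by
      rw [List.cons_append, List.nodup_cons] at hnd; exact hnd.1
    have hiL : i ∉ L := fun h => hi (by simp [h])
    simp only [lfold] at hfix
    have h0 := congrFun hfix i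
    rw [lfold_ne _ _ _ _ _ hiL, lref_same] at h0
    have hx : lref a i (L ++ M) x = x := by
      funext v
      by_cases hv : v = i
      · subst hv; rw [lref_same]; exact h0
      · rw [lref_ne _ _ _ _ hv]
    rw [hx] at hfix
    have hnd' : (L ++ (M ++ [i])).Nodup := by
      rw [← List.append_assoc, List.nodup_append_comm]; simpa using hnd
    have key := ih (M ++ [i]) hnd' x hfix
    intro j hj
    rw [List.mem_cons] at hj
    rcases hj with rfl | hj
    · have : ((j :: L ++ M).filter fun l => l ≠ j) = L ++ M := by
        rw [List.cons_append, List.filter_cons]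
        simp only [ne_eq, not_true_eq_false, decide_false, Bool.false_eq_true, if_false]
        rw [List.filter_eq_self]
        intro l hl
        simpa using fun e : l = j => hi (e ▸ hl)
      rw [this]; omega
    · have hk := key j hj
      have hp : (L ++ (M ++ [i])).Perm (i :: L ++ M) := by
        rw [← List.append_assoc]
        exact (List.perm_append_singleton i (L ++ M))
      rw [← ((hp.filter _).map _).sum_eq]
      exact hk

lemma lform_double {a : V → V → ℤ} (ha : ∀ i j, a i j = a j i) [DecidableEq V] (L : List V)
    (hL : L.Nodup) (x : V → ℤ) :
    2 * lform a L x x = (L.map fun i =>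
      x i * (2 * x i + ((L.filter fun j => j ≠ i).map fun j => a i j * x j).sum)).sum := by
  induction L with
  | nil => simp [lform]
  | cons i L ih =>
    rw [List.nodup_cons] at hL
    have e1 : ((i :: L).filter fun l => l ≠ i) = L := by
      rw [List.filter_cons]
      simp only [ne_eq, not_true_eq_false, decide_false, Bool.false_eq_true, if_false]
      rw [List.filter_eq_self]
      intro l hl
      simpa using fun e : l = i => hL.1 (e ▸ hl)
    have e2 : (L.map fun l =>
        x l * (2 * x l + (((i :: L).filter fun j => j ≠ l).map fun j => a l j * x j).sum))
        = L.map fun l => x l * (2 * x l + ((L.filter fun j => j ≠ l).map fun j => a l j * x j).sum)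
          + x i * (a i l * x l) := by
      apply List.map_congr_left
      intro l hl
      have : i ≠ l := fun e => hL.1 (e ▸ hl)
      rw [List.filter_cons]
      simp only [ne_eq, this, not_false_eq_true, decide_true, if_true, List.map_cons, List.sum_cons,
        ha l i]
      ring
    rw [List.map_cons, List.sum_cons, e1, e2, List.sum_map_add, ← ih hL.2, List.sum_map_mul_left]
    simp only [lform]
    ring

lemma lform_zero (a : V → V → ℤ) (L : List V) : lform a L 0 0 = 0 := by
  induction L with
  | nil => rfl
  | cons j L ih => simp [lform, ih]

lemma exists_dies {a : V → V → ℤ} {L : List V} (hL : Good a L)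
    (hfin : {x : V → ℤ | lform a L x x = 1}.Finite) {x : V → ℤ} (hx : PRoot a L x) :
    ∃ m, Dies a m L x := by
  classical
  by_contra hno
  set c : (V → ℤ) → (V → ℤ) := lfold a L [] with hc
  have hit : ∀ m : ℕ, PRoot a L (c^[m] x) ∧ ¬ ∃ n, Dies a n L (c^[m] x) := by
    intro m
    induction m with
    | zero => exact ⟨hx, hno⟩
    | succ m ih =>
      rw [Function.iterate_succ_apply']
      have := nostop_fold L [] (by simpa using hL) (c^[m] x) (by simpa using ih.1)
        (by simpa using ih.2)
      simpa using this
  have hni : ¬ Function.Injective (fun m : ℕ => c^[m] x) := by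
    intro hinj
    exact Set.infinite_of_injective_forall_mem hinj (s := {x : V → ℤ | lform a L x x = 1})
      (fun m => (hit m).1.2) hfin
  simp only [Function.Injective] at hni
  push Not at hni
  have : ∃ p q : ℕ, p < q ∧ c^[p] x = c^[q] x := by
    obtain ⟨p, q, h, hne⟩ := hni
    rcases lt_or_gt_of_ne hne with h' | h'
    · exact ⟨p, q, h', h⟩
    · exact ⟨q, p, h', h.symm⟩
  obtain ⟨p, q, hpq, he⟩ := this
  set β : V → ℤ := ∑ j ∈ Finset.Ico p q, c^[j] x with hβ
  have hc0 : c 0 = 0 := by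
    have := lfold_add a L [] 0 0
    rw [add_zero] at this
    exact (left_eq_add.1 this)
  let cH : (V → ℤ) →+ (V → ℤ) := ⟨⟨c, hc0⟩, lfold_add a L []⟩
  have hfix : c β = β := by
    change cH β = β
    rw [hβ, map_sum]
    have : ∀ j, cH (c^[j] x) = c^[j+1] x := by
      intro j; rw [Function.iterate_succ_apply']; rfl
    simp only [this]
    rw [Finset.sum_Ico_add' (fun j => c^[j] x) p q 1,
      Finset.sum_Ico_succ_top (by omega : p + 1 ≤ q), ← he, Finset.sum_eq_sum_Ico_succ_bot hpq,
      add_comm]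
  have h1 := lfold_fix L [] (by simpa using hL.nodup) β hfix
  have h2 := lform_double hL.symm L hL.nodup β
  have h3 : lform a L β β = 0 := by
    have : (L.map fun i =>
      β i * (2 * β i + ((L.filter fun j => j ≠ i).map fun j => a i j * β j).sum)).sum = 0 := by
      apply List.sum_eq_zero
      intro z hz
      rw [List.mem_map] at hz
      obtain ⟨i, hi, rfl⟩ := hz
      have := h1 i hi
      rw [List.append_nil] at this
      rw [this, mul_zero]
    omega
  have h4 : β = 0 := by
    by_contra h
    have := hL.pos β h
    omega
  have h5 : c^[p] x = 0 := by
    funext v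
    have h6 := congrFun h4 v
    rw [hβ, Finset.sum_apply, Pi.zero_apply,
      Finset.sum_eq_zero_iff_of_nonneg (fun j _ => (hit j).1.1 v)] at h6
    exact h6 p (by simp [hpq])
  have h6 := (hit p).1.2
  rw [h5, lform_zero] at h6
  omega

theorem exists_order {a : V → V → ℤ} {L : List V} (hL : Good a L)
    (hfin : {x : V → ℤ | lform a L x x = 1}.Finite) :
    ∃ f : (V → ℤ) → ℕ, ∀ x y, PRoot a L x → PRoot a L y →
      (f x = f y → x = y) ∧ (1 ≤ lform a L x y → f x ≤ f y) := by
  classical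
  refine ⟨fun x => if h : ∃ m, Dies a m L x then h.choose else 0, fun x y hx hy => ?_⟩
  have h1 := exists_dies hL hfin hx
  have h2 := exists_dies hL hfin hy
  simp only [dif_pos h1, dif_pos h2]
  refine ⟨fun h => ?_, fun h => ?_⟩
  · have := h2.choose_spec
    rw [← h] at this
    exact dies_inj _ L hL _ _ h1.choose_spec this
  · exact dies_mono _ _ L hL x y hx hy h1.choose_spec h2.choose_spec h
end Num

section Num2

variable (Q : FinQuiver)

def nar (u w : Q.V) : ℤ := (Fintype.card (u ⟶ w) : ℤ)
def amat (u w : Q.V) : ℤ := -(nar Q u w + nar Q w u)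

lemma euler_eq {R : Type} [CommRing R] (x y : Q.V → R) :
    euler Q x y = ∑ v, x v * y v - ∑ u, ∑ w, (Fintype.card (u ⟶ w) : R) * (x u * y w) := by
  unfold euler
  congr 1
  rw [Fintype.sum_sigma]
  refine Finset.sum_congr rfl fun u _ => ?_
  rw [Fintype.sum_sigma]
  refine Finset.sum_congr rfl fun w _ => ?_
  simp [Finset.sum_const, Finset.card_univ]

lemma exists_list : ∃ L : List Q.V, L.Nodup ∧ (∀ v, v ∈ L) ∧
    L.Pairwise (fun i j => IsEmpty (i ⟶ j)) := by
  classical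
  let h : Q.V → ℕ := fun v => (Finset.univ.filter fun w => Nonempty (Quiver.Path v w)).card
  have hh : ∀ i j : Q.V, (i ⟶ j) → h j < h i := by
    intro i j e
    apply Finset.card_lt_card
    rw [Finset.ssubset_iff_of_subset]
    · refine ⟨i, by simpa using ⟨Quiver.Path.nil⟩, ?_⟩
      simp only [Finset.mem_filter, Finset.mem_univ, true_and]
      rintro ⟨p⟩
      have := Q.acyclic j (p.cons e)
      cases this
    · intro w hw
      simp only [Finset.mem_filter, Finset.mem_univ, true_and] at hw ⊢
      obtain ⟨p⟩ := hw
      exact ⟨e.toPath.comp p⟩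
  let r : Q.V → Q.V → Prop := fun i j => h i ≤ h j
  have : Std.Total r := ⟨fun i j => le_total _ _⟩
  have : IsTrans Q.V r := ⟨fun i j k h1 h2 => le_trans h1 h2⟩
  refine ⟨(Finset.univ.toList).insertionSort r, ?_, ?_, ?_⟩
  · exact (List.perm_insertionSort r _).nodup_iff.2 (Finset.nodup_toList _)
  · intro v
    rw [(List.perm_insertionSort r _).mem_iff]; simp
  · refine (List.pairwise_insertionSort r _).imp ?_
    intro i j hij
    exact ⟨fun e => absurd (hh i j e) (not_lt.2 hij)⟩

lemma nar_self (i : Q.V) : nar Q i i = 0 := by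
  have : IsEmpty (i ⟶ i) := ⟨fun e => by
    have := Q.acyclic i e.toPath
    cases this⟩
  simp [nar]

lemma list_sum_neg {V : Type} (L : List V) (g : V → ℤ) :
    (L.map fun u => -(g u)).sum = -(L.map g).sum := by
  induction L with
  | nil => simp
  | cons i L ih => simp only [List.map_cons, List.sum_cons, ih]; ring

lemma lform_eq_list (L : List Q.V) (hL : L.Pairwise (fun i j => IsEmpty (i ⟶ j)))
    (x y : Q.V → ℤ) :
    lform (amat Q) L x y = (L.map fun v => x v * y v).sum
      - (L.map fun u => (L.map fun w => nar Q u w * (x u * y w)).sum).sum := by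
  induction L with
  | nil => simp [lform]
  | cons i L ih =>
    rw [List.pairwise_cons] at hL
    have e1 : (L.map fun j => amat Q i j * x j).sum * y i
        = -(L.map fun u => nar Q u i * (x u * y i)).sum := by
      rw [← List.sum_map_mul_right, ← list_sum_neg]
      congr 1
      apply List.map_congr_left
      intro j hj
      have := hL.1 j hj
      simp only [amat, nar, Fintype.card_eq_zero]
      push_cast; ring
    have e2 : (L.map fun w => nar Q i w * (x i * y w)).sum = 0 := by
      apply List.sum_eq_zero
      intro z hz
      rw [List.mem_map] at hz
      obtain ⟨w, hw, rfl⟩ := hz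
      have := hL.1 w hw
      simp [nar]
    simp only [lform, List.map_cons, List.sum_cons]
    rw [e1, e2, ih hL.2, nar_self, List.sum_map_add]
    ring

lemma lform_eq (L : List Q.V) (hL : L.Pairwise (fun i j => IsEmpty (i ⟶ j)))
    (hnd : L.Nodup) (hf : ∀ v, v ∈ L) (x y : Q.V → ℤ) :
    lform (amat Q) L x y = euler Q x y := by
  classical
  have key : ∀ g : Q.V → ℤ, (L.map g).sum = ∑ v, g v := by
    intro g
    have : L.toFinset = Finset.univ := by ext v; simp [hf v]
    rw [← this, List.sum_toFinset g hnd]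
  rw [lform_eq_list Q L hL, euler_eq, key, key]
  simp only [key, nar]

variable {Q}

lemma euler_pos (hft : FiniteType Q) (x : Q.V → ℤ) (hx : x ≠ 0) : 1 ≤ euler Q x x := by
  have h := hft (fun v => (x v : ℚ)) (by
    intro h; apply hx; funext v; have := congrFun h v; simpa using this)
  have e : symEuler Q (fun v => (x v : ℚ)) (fun v => (x v : ℚ)) = ((2 * euler Q x x : ℤ) : ℚ) := by
    unfold symEuler
    simp only [euler_eq]
    push_cast
    ring
  rw [e] at h
  have : 0 < 2 * euler Q x x := by exact_mod_cast h
  omega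

lemma euler_add_left {R : Type} [CommRing R] (x y z : Q.V → R) :
    euler Q (x + y) z = euler Q x z + euler Q y z := by
  simp only [euler, Pi.add_apply, add_mul, Finset.sum_add_distrib]; ring
lemma euler_add_right {R : Type} [CommRing R] (x y z : Q.V → R) :
    euler Q z (x + y) = euler Q z x + euler Q z y := by
  simp only [euler, Pi.add_apply, mul_add, Finset.sum_add_distrib]; ring
lemma euler_smul_left {R : Type} [CommRing R] (c : R) (x z : Q.V → R) :
    euler Q (c • x) z = c * euler Q x z := by
  simp only [euler, Pi.smul_apply, smul_eq_mul, mul_sub, Finset.mul_sum, mul_assoc]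
lemma euler_smul_right {R : Type} [CommRing R] (c : R) (x z : Q.V → R) :
    euler Q z (c • x) = c * euler Q z x := by
  simp only [euler, Pi.smul_apply, smul_eq_mul, mul_sub, Finset.mul_sum, mul_left_comm]

def symB (Q : FinQuiver) : LinearMap.BilinForm ℚ (Q.V → ℚ) :=
  LinearMap.mk₂ ℚ (fun x y => symEuler Q x y)
    (by intros; simp only [symEuler, euler_add_left, euler_add_right]; ring)
    (by intros; simp only [symEuler, euler_smul_left, euler_smul_right, smul_eq_mul]; ring)
    (by intros; simp only [symEuler, euler_add_left, euler_add_right]; ring)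
    (by intros; simp only [symEuler, euler_smul_left, euler_smul_right, smul_eq_mul]; ring)

lemma cauchy (hft : FiniteType Q) (x y : Q.V → ℚ) :
    symEuler Q x y ^ 2 ≤ symEuler Q x x * symEuler Q y y := by
  by_cases hy : y = 0
  · subst hy
    have h1 : symEuler Q x 0 = 0 := (symB Q x).map_zero
    have h2 : symEuler Q (0 : Q.V → ℚ) 0 = 0 := (symB Q 0).map_zero
    rw [h1, h2]; simp
  · have hp := hft y hy
    have hn : ∀ z : Q.V → ℚ, 0 ≤ symEuler Q z z := by
      intro z
      by_cases hz : z = 0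
      · subst hz
        exact le_of_eq ((symB Q 0).map_zero).symm
      · exact (hft z hz).le
    have h := hn (symEuler Q y y • x + (- symEuler Q x y) • y)
    have e : symEuler Q (symEuler Q y y • x + (- symEuler Q x y) • y)
        (symEuler Q y y • x + (- symEuler Q x y) • y)
        = symEuler Q y y * (symEuler Q x x * symEuler Q y y - symEuler Q x y ^ 2) := by
      generalize hc : symEuler Q y y = c
      generalize hd : symEuler Q x y = d
      have hd' : symEuler Q y x = d := by rw [← hd]; simp only [symEuler]; ring
      have : symEuler Q (c • x + (-d) • y) (c • x + (-d) • y)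
        = c * c * symEuler Q x x - c * d * (symEuler Q x y) - c * d * symEuler Q y x
          + d * d * symEuler Q y y := by
        simp only [symEuler, euler_add_left, euler_add_right, euler_smul_left, euler_smul_right]
        ring
      rw [this, hc, hd, hd']; ring
    rw [e] at h
    nlinarith [(mul_nonneg_iff_of_pos_left hp).1 h]

lemma roots_finite (hft : FiniteType Q) : {x : Q.V → ℤ | euler Q x x = 1}.Finite := by
  classical
  have hinj : Function.Injective (symB Q) := by
    rw [injective_iff_map_eq_zero]
    intro x hx
    by_contra hne
    have h1 := hft x hne
    have h2 : symEuler Q x x = 0 := by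
      have := LinearMap.congr_fun hx x
      simpa [symB] using this
    linarith
  have hsurj : Function.Surjective (symB Q) := by
    have := LinearMap.injective_iff_surjective_of_finrank_eq_finrank
      (f := symB Q) (by rw [Subspace.dual_finrank_eq])
    exact this.1 hinj
  have hw : ∀ v : Q.V, ∃ w : Q.V → ℚ, ∀ x : Q.V → ℚ, symEuler Q w x = x v := by
    intro v
    obtain ⟨w, hw⟩ := hsurj (LinearMap.proj v)
    refine ⟨w, fun x => ?_⟩
    have := LinearMap.congr_fun hw x
    simpa [symB] using this
  choose w hw using hw
  have hbd : ∀ v : Q.V, ∃ N : ℕ, ∀ x : Q.V → ℤ, euler Q x x = 1 → |x v| ≤ N := by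
    intro v
    obtain ⟨N, hN⟩ := exists_nat_ge (symEuler Q (w v) (w v) * 2)
    refine ⟨N, fun x hx => ?_⟩
    have h := cauchy hft (w v) (fun v => (x v : ℚ))
    have e : symEuler Q (fun v => (x v : ℚ)) (fun v => (x v : ℚ))
        = ((2 * euler Q x x : ℤ) : ℚ) := by
      unfold symEuler
      simp only [euler_eq]
      push_cast
      ring
    rw [hw, e, hx] at h
    have h2 : ((x v : ℚ)) ^ 2 ≤ N := by
      push_cast at h
      linarith
    have h3 : (x v) ^ 2 ≤ (N : ℤ) := by exact_mod_cast h2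
    nlinarith [abs_nonneg (x v), sq_abs (x v), sq_nonneg (|x v| - 1)]
  choose N hN using hbd
  refine Set.Finite.subset (Set.finite_Icc (fun v => -(N v : ℤ)) (fun v => (N v : ℤ))) ?_
  intro x hx
  rw [Set.mem_Icc]
  exact ⟨fun v => (abs_le.1 (hN v x hx)).1, fun v => (abs_le.1 (hN v x hx)).2⟩

theorem exists_rootorder (hft : FiniteType Q) :
    ∃ f : (Q.V → ℤ) → ℕ, ∀ x y : Q.V → ℤ, (∀ v, 0 ≤ x v) → (∀ v, 0 ≤ y v) →
      euler Q x x = 1 → euler Q y y = 1 →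
      (f x = f y → x = y) ∧ (1 ≤ euler Q x y → f x ≤ f y) := by
  obtain ⟨L, h1, h2, h3⟩ := exists_list Q
  have he := lform_eq Q L h3 h1 h2
  have hg : Good (amat Q) L :=
    { symm := fun i j => by simp only [amat]; ring
      nonpos := fun i j _ => by simp only [amat, nar]; omega
      nodup := h1
      full := h2
      pos := fun x hx => by rw [he]; exact euler_pos hft x hx }
  obtain ⟨f, hf⟩ := exists_order hg (by simp only [he]; exact roots_finite hft)
  refine ⟨f, fun x y hx hy h4 h5 => ?_⟩
  have := hf x y ⟨hx, by rw [he]; exact h4⟩ ⟨hy, by rw [he]; exact h5⟩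
  rw [he] at this
  exact this

end Num2

section Rep
variable {k : Type} [Field k] {Q : FinQuiver}

abbrev ob (M : RepC k Q) (v : Q.V) : ModuleCat k := M.obj ((Paths.of Q.V).obj v)
abbrev ar (M : RepC k Q) {u w : Q.V} (e : u ⟶ w) : ob M u →ₗ[k] ob M w :=
  (M.map ((Paths.of Q.V).map e)).hom
abbrev ap {M N : RepC k Q} (f : M ⟶ N) (v : Q.V) : ob M v →ₗ[k] ob N v :=
  (f.app ((Paths.of Q.V).obj v)).hom

lemma ap_nat {M N : RepC k Q} (f : M ⟶ N) {u w : Q.V} (e : u ⟶ w) (x : ob M u) :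
    ap f w (ar M e x) = ar N e (ap f u x) := by
  have := congrArg (fun g => ModuleCat.Hom.hom g x) (f.naturality ((Paths.of Q.V).map e))
  exact this

lemma hom_ext' {M N : RepC k Q} {f g : M ⟶ N} (h : ∀ v, ap f v = ap g v) : f = g := by
  apply NatTrans.ext
  funext v
  exact ModuleCat.hom_ext (h v)

def mkHom {M N : RepC k Q} (h : ∀ v, ob M v →ₗ[k] ob N v)
    (comm : ∀ (u w : Q.V) (e : u ⟶ w) (x : ob M u), h w (ar M e x) = ar N e (h u x)) : M ⟶ N where
  app v := ModuleCat.ofHom (h v)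
  naturality := by
    intro u w p
    induction p using Paths.induction with
    | id => simp
    | comp p q ih =>
      rename_i a b c
      have hq : M.map ((Paths.of Q.V).map q) ≫ ModuleCat.ofHom (h c)
          = ModuleCat.ofHom (h b) ≫ N.map ((Paths.of Q.V).map q) := by
        apply ModuleCat.hom_ext
        ext x
        exact comm b c q x
      rw [M.map_comp, N.map_comp, Category.assoc]
      refine (congrArg (M.map p ≫ ·) hq).trans ?_
      refine (Category.assoc _ _ _).symm.trans ?_
      refine (congrArg (· ≫ N.map ((Paths.of Q.V).map q)) ih).trans ?_
      exact Category.assoc _ _ _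

@[simp] lemma ap_mkHom {M N : RepC k Q} (h : ∀ v, ob M v →ₗ[k] ob N v) (comm) (v : Q.V) :
    ap (mkHom h comm) v = h v := rfl

lemma ap_comp {M N P : RepC k Q} (f : M ⟶ N) (g : N ⟶ P) (v : Q.V) (x : ob M v) :
    ap (f ≫ g) v x = ap g v (ap f v x) := rfl
lemma ap_id (M : RepC k Q) (v : Q.V) (x : ob M v) : ap (𝟙 M) v x = x := rfl
lemma ap_zero (M N : RepC k Q) (v : Q.V) (x : ob M v) : ap (0 : M ⟶ N) v x = 0 := rfl
lemma ap_add {M N : RepC k Q} (f g : M ⟶ N) (v : Q.V) : ap (f + g) v = ap f v + ap g v := rfl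
lemma ap_sub {M N : RepC k Q} (f g : M ⟶ N) (v : Q.V) : ap (f - g) v = ap f v - ap g v := rfl
lemma ap_smul {M N : RepC k Q} (c : k) (f : M ⟶ N) (v : Q.V) : ap (c • f) v = c • ap f v := rfl

def apL (M N : RepC k Q) (v : Q.V) : (M ⟶ N) →ₗ[k] (ob M v →ₗ[k] ob N v) where
  toFun f := ap f v
  map_add' _ _ := rfl
  map_smul' _ _ := rfl

lemma ap_sum {M N : RepC k Q} {ι : Type} (s : Finset ι) (f : ι → (M ⟶ N)) (v : Q.V) :
    ap (∑ i ∈ s, f i) v = ∑ i ∈ s, ap (f i) v := map_sum (apL M N v) f s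

lemma mono_iff {M N : RepC k Q} (f : M ⟶ N) : Mono f ↔ ∀ v, Function.Injective (ap f v) := by
  rw [NatTrans.mono_iff_mono_app]
  exact forall_congr' fun v => ModuleCat.mono_iff_injective _

lemma epi_iff {M N : RepC k Q} (f : M ⟶ N) : Epi f ↔ ∀ v, Function.Surjective (ap f v) := by
  rw [NatTrans.epi_iff_epi_app]
  exact forall_congr' fun v => ModuleCat.epi_iff_surjective _

lemma exact_app {S : ShortComplex (RepC k Q)} (h : S.ShortExact) (v : Q.V) :
    Function.Exact (ap S.f v) (ap S.g v) := by
  have h1 := h.exact.map ((CategoryTheory.evaluation (Paths Q.V) (ModuleCat k)).obj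
    ((Paths.of Q.V).obj v))
  exact (ShortComplex.ShortExact.moduleCat_exact_iff_function_exact _).1 h1

/-- vanishing of `Ext¹`, concretely -/
def E0 (X Y : RepC k Q) : Prop :=
  ∀ d : (∀ (u w : Q.V) (_ : u ⟶ w), ob X u →ₗ[k] ob Y w),
    ∃ h : (∀ v, ob X v →ₗ[k] ob Y v), ∀ (u w : Q.V) (e : u ⟶ w) (x : ob X u),
      d u w e x = ar Y e (h u x) - h w (ar X e x)

lemma E0.quot {X Y Y' : RepC k Q} (h : E0 X Y) (p : Y ⟶ Y') [Epi p] : E0 X Y' := by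
  have hs := (epi_iff p).1 inferInstance
  have hs' : ∀ v, ∃ s : ob Y' v →ₗ[k] ob Y v, ap p v ∘ₗ s = LinearMap.id := fun v =>
    LinearMap.exists_rightInverse_of_surjective _ (LinearMap.range_eq_top.2 (hs v))
  choose s hs' using hs'
  have hs'' : ∀ v x, ap p v (s v x) = x := fun v x => LinearMap.congr_fun (hs' v) x
  intro d
  obtain ⟨g, hg⟩ := h (fun u w e => s w ∘ₗ d u w e)
  refine ⟨fun v => ap p v ∘ₗ g v, fun u w e x => ?_⟩
  have := congrArg (ap p w) (hg u w e x)
  simp only [LinearMap.comp_apply, hs'', map_sub, ap_nat] at this ⊢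
  exact this

lemma E0.sub {X X' Y : RepC k Q} (h : E0 X Y) (i : X' ⟶ X) [Mono i] : E0 X' Y := by
  have hs := (mono_iff i).1 inferInstance
  have hs' : ∀ v, ∃ s : ob X v →ₗ[k] ob X' v, s ∘ₗ ap i v = LinearMap.id := fun v =>
    LinearMap.exists_leftInverse_of_injective _ (LinearMap.ker_eq_bot.2 (hs v))
  choose s hs' using hs'
  have hs'' : ∀ v x, s v (ap i v x) = x := fun v x => LinearMap.congr_fun (hs' v) x
  intro d
  obtain ⟨g, hg⟩ := h (fun u w e => d u w e ∘ₗ s u)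
  refine ⟨fun v => g v ∘ₗ ap i v, fun u w e x => ?_⟩
  have := hg u w e (ap i u x)
  simp only [LinearMap.comp_apply, hs''] at this ⊢
  rw [this, ap_nat]

lemma E0.bip {X Y : RepC k Q} {n : ℕ} (f : Fin n → RepC k Q) (ι : ∀ i, f i ⟶ Y) (π : ∀ i, Y ⟶ f i)
    (hs : ∑ i, π i ≫ ι i = 𝟙 Y) (h : ∀ i, E0 X (f i)) : E0 X Y := by
  have hs' : ∀ v (y : ob Y v), ∑ i, ap (ι i) v (ap (π i) v y) = y := by
    intro v y
    have := congrArg (fun g => ap g v y) hs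
    simp only [ap_sum, LinearMap.sum_apply] at this
    exact this
  intro d
  choose g hg using fun i => h i (fun u w e => ap (π i) w ∘ₗ d u w e)
  refine ⟨fun v => ∑ i, ap (ι i) v ∘ₗ g i v, fun u w e x => ?_⟩
  rw [← hs' w (d u w e x)]
  simp only [LinearMap.sum_apply, LinearMap.comp_apply, map_sum, ← Finset.sum_sub_distrib]
  refine Finset.sum_congr rfl fun i _ => ?_
  have := congrArg (ap (ι i) w) (hg i u w e x)
  simp only [LinearMap.comp_apply, map_sub, ap_nat] at this
  exact this

lemma E0.lift {S : ShortComplex (RepC k Q)} (hS : S.ShortExact) {M : RepC k Q}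
    (h : E0 M S.X₁) (f : M ⟶ S.X₃) : ∃ g : M ⟶ S.X₂, g ≫ S.g = f := by
  have := hS.mono_f
  have := hS.epi_g
  have hi := (mono_iff S.f).1 inferInstance
  have hs := (epi_iff S.g).1 inferInstance
  have hs' : ∀ v, ∃ s : ob S.X₃ v →ₗ[k] ob S.X₂ v, ap S.g v ∘ₗ s = LinearMap.id := fun v =>
    LinearMap.exists_rightInverse_of_surjective _ (LinearMap.range_eq_top.2 (hs v))
  choose s hs' using hs'
  have hs'' : ∀ v x, ap S.g v (s v x) = x := fun v x => LinearMap.congr_fun (hs' v) x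
  have hr' : ∀ v, ∃ r : ob S.X₂ v →ₗ[k] ob S.X₁ v, r ∘ₗ ap S.f v = LinearMap.id := fun v =>
    LinearMap.exists_leftInverse_of_injective _ (LinearMap.ker_eq_bot.2 (hi v))
  choose r hr' using hr'
  have hr'' : ∀ v x, ap S.g v x = 0 → ap S.f v (r v x) = x := by
    intro v x hx
    obtain ⟨y, rfl⟩ := (exact_app hS v x).1 hx
    congr 1
    exact LinearMap.congr_fun (hr' v) y
  have hz : ∀ v y, ap S.g v (ap S.f v y) = 0 := fun v y => (exact_app hS v _).2 ⟨y, rfl⟩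
  obtain ⟨g, hg⟩ := h (fun u w e => r w ∘ₗ (ar S.X₂ e ∘ₗ s u ∘ₗ ap f u - s w ∘ₗ ap f w ∘ₗ ar M e))
  refine ⟨mkHom (fun v => s v ∘ₗ ap f v - ap S.f v ∘ₗ g v) ?_, ?_⟩
  · intro u w e x
    have h1 := congrArg (ap S.f w) (hg u w e x)
    rw [LinearMap.comp_apply, hr''] at h1
    · simp only [LinearMap.comp_apply, LinearMap.sub_apply, map_sub, ap_nat] at h1 ⊢
      rw [sub_eq_sub_iff_sub_eq_sub, ← neg_sub, h1, neg_sub]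
    · simp only [LinearMap.comp_apply, LinearMap.sub_apply, map_sub, ap_nat, hs'', sub_self]
  · apply hom_ext'
    intro v
    ext x
    rw [ap_comp, ap_mkHom]
    simp only [LinearMap.comp_apply, LinearMap.sub_apply, map_sub, hs'', hz, sub_zero]

lemma E0.extend {S : ShortComplex (RepC k Q)} (hS : S.ShortExact) {Z : RepC k Q}
    (h : E0 S.X₃ Z) (f : S.X₁ ⟶ Z) : ∃ g : S.X₂ ⟶ Z, S.f ≫ g = f := by
  have := hS.mono_f
  have := hS.epi_g
  have hi := (mono_iff S.f).1 inferInstance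
  have hs := (epi_iff S.g).1 inferInstance
  have hs' : ∀ v, ∃ s : ob S.X₃ v →ₗ[k] ob S.X₂ v, ap S.g v ∘ₗ s = LinearMap.id := fun v =>
    LinearMap.exists_rightInverse_of_surjective _ (LinearMap.range_eq_top.2 (hs v))
  choose s hs' using hs'
  have hs'' : ∀ v x, ap S.g v (s v x) = x := fun v x => LinearMap.congr_fun (hs' v) x
  have hr' : ∀ v, ∃ r : ob S.X₂ v →ₗ[k] ob S.X₁ v, r ∘ₗ ap S.f v = LinearMap.id := fun v =>
    LinearMap.exists_leftInverse_of_injective _ (LinearMap.ker_eq_bot.2 (hi v))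
  choose r hr' using hr'
  have hrf : ∀ v y, r v (ap S.f v y) = y := fun v y => LinearMap.congr_fun (hr' v) y
  have hz : ∀ v y, ap S.g v (ap S.f v y) = 0 := fun v y => (exact_app hS v _).2 ⟨y, rfl⟩
  -- defect
  obtain ⟨g, hg⟩ := h (fun u w e =>
    (ar Z e ∘ₗ ap f u ∘ₗ r u - ap f w ∘ₗ r w ∘ₗ ar S.X₂ e) ∘ₗ s u)
  refine ⟨mkHom (fun v => ap f v ∘ₗ r v - g v ∘ₗ ap S.g v) ?_, ?_⟩
  · intro u w e x
    obtain ⟨y, hy⟩ : ∃ y, ap S.f u y = x - s u (ap S.g u x) := by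
      apply (exact_app hS u _).1
      simp only [map_sub, hs'', sub_self]
    have hx : x = ap S.f u y + s u (ap S.g u x) := by rw [hy]; abel
    have h1 := hg u w e (ap S.g u x)
    have h2 : ar Z e (ap f u (r u (ap S.f u y))) - ap f w (r w (ar S.X₂ e (ap S.f u y))) = 0 := by
      rw [hrf, ← ap_nat S.f, hrf, ap_nat, sub_self]
    have h3 : ar Z e (ap f u (r u x)) - ap f w (r w (ar S.X₂ e x))
        = ar Z e (g u (ap S.g u x)) - g w (ar S.X₃ e (ap S.g u x)) := by
      rw [← h1]
      conv_lhs => rw [hx]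
      simp only [map_add, LinearMap.comp_apply, LinearMap.sub_apply]
      rw [add_sub_add_comm, h2, zero_add]
    simp only [LinearMap.comp_apply, LinearMap.sub_apply, map_sub, ap_nat] at h3 ⊢
    rw [sub_eq_sub_iff_sub_eq_sub, ← neg_sub, h3, neg_sub]
  · apply hom_ext'
    intro v
    ext x
    rw [ap_comp, ap_mkHom]
    simp only [LinearMap.comp_apply, LinearMap.sub_apply, map_sub, hrf, hz, map_zero, sub_zero]

/-- the map whose kernel is `Hom` and cokernel is `Ext` -/
def phi (X Y : RepC k Q) : (∀ v, ob X v →ₗ[k] ob Y v) →ₗ[k]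
    (∀ a : (Σ u : Q.V, Σ w : Q.V, u ⟶ w), ob X a.1 →ₗ[k] ob Y a.2.1) where
  toFun h a := ar Y a.2.2 ∘ₗ h a.1 - h a.2.1 ∘ₗ ar X a.2.2
  map_add' f g := by
    funext a; ext x; simp only [Pi.add_apply, LinearMap.sub_apply, LinearMap.comp_apply,
      LinearMap.add_apply, map_add]; abel
  map_smul' c f := by
    funext a; ext x; simp only [Pi.smul_apply, LinearMap.sub_apply, LinearMap.comp_apply,
      LinearMap.smul_apply, map_smul, smul_sub, RingHom.id_apply]

lemma E0_iff (X Y : RepC k Q) : E0 X Y ↔ Function.Surjective (phi X Y) := by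
  constructor
  · intro h d
    obtain ⟨g, hg⟩ := h (fun u w e => d ⟨u, w, e⟩)
    refine ⟨g, ?_⟩
    funext ⟨u, w, e⟩
    ext x
    exact (hg u w e x).symm
  · intro h d
    obtain ⟨g, hg⟩ := h (fun a => d a.1 a.2.1 a.2.2)
    refine ⟨g, fun u w e x => ?_⟩
    have := congrFun hg ⟨u, w, e⟩
    exact (LinearMap.congr_fun this x).symm

def kerHom (X Y : RepC k Q) : (X ⟶ Y) ≃ₗ[k] LinearMap.ker (phi X Y) where
  toFun f := ⟨fun v => ap f v, by
    rw [LinearMap.mem_ker]; funext ⟨u, w, e⟩; ext x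
    change ar Y e (ap f u x) - ap f w (ar X e x) = 0
    rw [ap_nat, sub_self]⟩
  map_add' _ _ := rfl
  map_smul' _ _ := rfl
  invFun h := mkHom h.1 (by
    intro u w e x
    have := LinearMap.congr_fun (congrFun (LinearMap.mem_ker.1 h.2) ⟨u, w, e⟩) x
    exact (sub_eq_zero.1 this).symm)
  left_inv _ := rfl
  right_inv _ := rfl

section fd
variable {X Y : RepC k Q} (hX : FinDim X) (hY : FinDim Y)
include hX hY

lemma hom_finite : FiniteDimensional k (X ⟶ Y) := by
  have : ∀ v, FiniteDimensional k (ob X v) := hX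
  have : ∀ v, FiniteDimensional k (ob Y v) := hY
  exact Module.Finite.equiv (kerHom X Y).symm

lemma euler_dim : euler Q (dimVec X) (dimVec Y) =
    (Module.finrank k (∀ v, ob X v →ₗ[k] ob Y v) : ℤ)
    - Module.finrank k (∀ a : (Σ u : Q.V, Σ w : Q.V, u ⟶ w), ob X a.1 →ₗ[k] ob Y a.2.1) := by
  have : ∀ v, FiniteDimensional k (ob X v) := hX
  have : ∀ v, FiniteDimensional k (ob Y v) := hY
  rw [Module.finrank_pi_fintype, Module.finrank_pi_fintype]
  simp only [Module.finrank_linearMap]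
  push_cast
  rfl

lemma euler_phi : euler Q (dimVec X) (dimVec Y) =
    (Module.finrank k (X ⟶ Y) : ℤ) + Module.finrank k (LinearMap.range (phi X Y))
    - Module.finrank k (∀ a : (Σ u : Q.V, Σ w : Q.V, u ⟶ w), ob X a.1 →ₗ[k] ob Y a.2.1) := by
  have : ∀ v, FiniteDimensional k (ob X v) := hX
  have : ∀ v, FiniteDimensional k (ob Y v) := hY
  rw [euler_dim hX hY, ← LinearMap.finrank_range_add_finrank_ker (phi X Y),
    (kerHom X Y).finrank_eq]
  push_cast
  ring

lemma euler_le : euler Q (dimVec X) (dimVec Y) ≤ Module.finrank k (X ⟶ Y) := by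
  have : ∀ v, FiniteDimensional k (ob X v) := hX
  have : ∀ v, FiniteDimensional k (ob Y v) := hY
  rw [euler_phi hX hY]
  have := Submodule.finrank_le (LinearMap.range (phi X Y))
  omega

lemma E0_iff_euler : E0 X Y ↔ euler Q (dimVec X) (dimVec Y) = Module.finrank k (X ⟶ Y) := by
  have : ∀ v, FiniteDimensional k (ob X v) := hX
  have : ∀ v, FiniteDimensional k (ob Y v) := hY
  rw [E0_iff, ← LinearMap.range_eq_top, euler_phi hX hY]
  constructor
  · intro h
    rw [h, finrank_top]; ring
  · intro h
    apply Submodule.eq_top_of_finrank_eq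
    omega

end fd
end Rep

section Bas
variable {k : Type} [Field k] {Q : FinQuiver}

def dd (X : RepC k Q) : ℕ := ∑ v, Module.finrank k (ob X v)

lemma fd_mono {X Y : RepC k Q} (i : X ⟶ Y) [Mono i] (hY : FinDim Y) : FinDim X := fun v => by
  have : FiniteDimensional k (ob Y v) := hY v
  exact FiniteDimensional.of_injective (ap i v) ((mono_iff i).1 inferInstance v)

lemma fd_epi {X Y : RepC k Q} (p : X ⟶ Y) [Epi p] (hX : FinDim X) : FinDim Y := fun v => by
  have : FiniteDimensional k (ob X v) := hX v
  exact Module.Finite.of_surjective (ap p v) ((epi_iff p).1 inferInstance v)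

lemma dd_mono {X Y : RepC k Q} (i : X ⟶ Y) [Mono i] (hY : FinDim Y) : dd X ≤ dd Y :=
  Finset.sum_le_sum fun v _ => by
    have : FiniteDimensional k (ob Y v) := hY v
    exact LinearMap.finrank_le_finrank_of_injective ((mono_iff i).1 inferInstance v)

lemma dd_epi {X Y : RepC k Q} (p : X ⟶ Y) [Epi p] (hX : FinDim X) : dd Y ≤ dd X :=
  Finset.sum_le_sum fun v _ => by
    have : FiniteDimensional k (ob X v) := hX v
    exact LinearMap.finrank_le_finrank_of_surjective ((epi_iff p).1 inferInstance v)

lemma iso_of_mono {X Y : RepC k Q} (i : X ⟶ Y) [Mono i] (hY : FinDim Y) (h : dd Y ≤ dd X) :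
    IsIso i := by
  have hX := fd_mono i hY
  have h1 : ∀ v, Module.finrank k (ob X v) ≤ Module.finrank k (ob Y v) := fun v => by
    have : FiniteDimensional k (ob Y v) := hY v
    exact LinearMap.finrank_le_finrank_of_injective ((mono_iff i).1 inferInstance v)
  have h2 : dd X = dd Y := le_antisymm (dd_mono i hY) h
  have h3 := (Finset.sum_eq_sum_iff_of_le (fun v _ => h1 v)).1 h2
  have : Epi i := by
    rw [epi_iff]
    intro v
    have : FiniteDimensional k (ob Y v) := hY v
    have : FiniteDimensional k (ob X v) := hX v
    exact (LinearMap.injective_iff_surjective_of_finrank_eq_finrank (h3 v (Finset.mem_univ _))).1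
      ((mono_iff i).1 inferInstance v)
  exact isIso_of_mono_of_epi i

lemma iso_of_epi {X Y : RepC k Q} (i : X ⟶ Y) [Epi i] (hX : FinDim X) (h : dd X ≤ dd Y) :
    IsIso i := by
  have hY := fd_epi i hX
  have h1 : ∀ v, Module.finrank k (ob Y v) ≤ Module.finrank k (ob X v) := fun v => by
    have : FiniteDimensional k (ob X v) := hX v
    exact LinearMap.finrank_le_finrank_of_surjective ((epi_iff i).1 inferInstance v)
  have h2 : dd Y = dd X := le_antisymm (dd_epi i hX) h
  have h3 := (Finset.sum_eq_sum_iff_of_le (fun v _ => h1 v)).1 h2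
  have : Mono i := by
    rw [mono_iff]
    intro v
    have : FiniteDimensional k (ob Y v) := hY v
    have : FiniteDimensional k (ob X v) := hX v
    exact (LinearMap.injective_iff_surjective_of_finrank_eq_finrank
      (h3 v (Finset.mem_univ _)).symm).2 ((epi_iff i).1 inferInstance v)
  exact isIso_of_mono_of_epi i

lemma dimVec_iso {X Y : RepC k Q} (e : X ≅ Y) : dimVec X = dimVec Y := by
  funext v
  have h1 : Function.Bijective (ap e.hom v) :=
    ⟨(mono_iff e.hom).1 inferInstance v, (epi_iff e.hom).1 inferInstance v⟩
  exact congrArg Nat.cast (LinearEquiv.ofBijective _ h1).finrank_eq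

lemma dd_eq {X Y : RepC k Q} (e : dimVec X = dimVec Y) : dd X = dd Y :=
  Finset.sum_congr rfl fun v _ => Int.ofNat_inj.1 (congrFun e v)

lemma fd_zero {X : RepC k Q} (h : IsZero X) : FinDim X := fun v => by
  have : Subsingleton (ob X v) := ⟨fun a b => by
    rw [← ap_id X v a, ← ap_id X v b, (IsZero.iff_id_eq_zero X).1 h]; rfl⟩
  infer_instance

lemma isZero_of_dd {X : RepC k Q} (hX : FinDim X) (h : dd X = 0) : IsZero X := by
  rw [IsZero.iff_id_eq_zero]
  apply hom_ext'
  intro v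
  ext x
  have : FiniteDimensional k (ob X v) := hX v
  have h0 : Module.finrank k (ob X v) = 0 := (Finset.sum_eq_zero_iff.1 h) v (Finset.mem_univ v)
  have := Module.finrank_zero_iff.1 h0
  exact Subsingleton.elim _ _

lemma dimVec_ne {X : RepC k Q} (hX : FinDim X) (h : ¬ IsZero X) : dimVec X ≠ 0 := fun h0 => by
  apply h
  apply isZero_of_dd hX
  apply Finset.sum_eq_zero
  intro v _
  exact Int.ofNat_inj.1 (congrFun h0 v)

lemma fd_ext {S : ShortComplex (RepC k Q)} (hS : S.ShortExact) (h1 : FinDim S.X₁)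
    (h3 : FinDim S.X₃) : FinDim S.X₂ := fun v => by
  have : FiniteDimensional k (ob S.X₁ v) := h1 v
  have : FiniteDimensional k (ob S.X₃ v) := h3 v
  have := hS.epi_g
  exact Module.Finite.of_exact (exact_app hS v) ((epi_iff S.g).1 inferInstance v)

lemma dd_ext {S : ShortComplex (RepC k Q)} (hS : S.ShortExact) (h2 : FinDim S.X₂) :
    dd S.X₂ = dd S.X₁ + dd S.X₃ := by
  have := hS.mono_f
  have := hS.epi_g
  rw [dd, dd, dd, ← Finset.sum_add_distrib]
  apply Finset.sum_congr rfl
  intro v _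
  have : FiniteDimensional k (ob S.X₂ v) := h2 v
  have h := LinearMap.finrank_range_add_finrank_ker (ap S.g v)
  rw [LinearMap.exact_iff.1 (exact_app hS v), LinearMap.range_eq_top.2 ((epi_iff S.g).1 inferInstance v),
    finrank_top, LinearMap.finrank_range_of_inj ((mono_iff S.f).1 inferInstance v)] at h
  omega

lemma biprod_se (A B : RepC k Q) :
    (ShortComplex.mk (biprod.inl : A ⟶ A ⊞ B) (biprod.snd : A ⊞ B ⟶ B) (by simp)).ShortExact :=
  (ShortComplex.Splitting.ofHasBinaryBiproduct A B).shortExact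

lemma ker_se {A B : RepC k Q} (q : A ⟶ B) [Epi q] :
    (ShortComplex.mk (kernel.ι q) q (by simp)).ShortExact where
  exact := ShortComplex.exact_kernel q
  mono_f := inferInstance
  epi_g := ‹_›

lemma coker_se {A B : RepC k Q} (q : A ⟶ B) [Mono q] :
    (ShortComplex.mk q (cokernel.π q) (by simp)).ShortExact where
  exact := ShortComplex.exact_cokernel q
  mono_f := ‹_›
  epi_g := inferInstance

lemma fd_bip {Y : RepC k Q} {n : ℕ} (f : Fin n → RepC k Q) (ι : ∀ i, f i ⟶ Y) (π : ∀ i, Y ⟶ f i)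
    (hs : ∑ i, π i ≫ ι i = 𝟙 Y) (h : ∀ i, FinDim (f i)) : FinDim Y := fun v => by
  have : ∀ i, FiniteDimensional k (ob (f i) v) := fun i => h i v
  refine FiniteDimensional.of_injective (LinearMap.pi fun i => ap (π i) v :
    ob Y v →ₗ[k] (∀ i, ob (f i) v)) ?_
  rw [← LinearMap.ker_eq_bot, LinearMap.ker_eq_bot']
  intro y hy
  rw [← ap_id Y v y, ← hs, ap_sum, LinearMap.sum_apply]
  apply Finset.sum_eq_zero
  intro i _
  rw [ap_comp]
  have := congrFun hy i
  simp only [LinearMap.pi_apply] at this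
  rw [this]; simp

lemma fd_sum {n : ℕ} (f : Fin n → RepC k Q) (h : ∀ i, FinDim (f i)) : FinDim (⨁ f) :=
  fd_bip f (fun i => biproduct.ι f i) (fun i => biproduct.π f i) (biproduct.total (f := f)) h

lemma tors_fd : Tors {X : RepC k Q | FinDim X} where
  left :=
    { zero_mem := fd_zero (isZero_zero _)
      sum_mem := fun X hX Y hY => fd_ext (biprod_se X Y) hX hY
      summand_mem := fun X hX Y ⟨i, r, h⟩ => by
        have : Mono i := (SplitMono.mk r h).mono
        exact fd_mono i hX
      quot_mem := fun X hX Y p hp => fd_epi p hX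
      ext_mem := fun S hS h1 h3 => fd_ext hS h1 h3 }
  right := fun X hX => hX

/-- a split mono gives a decomposition -/
def retIso {A B : RepC k Q} (i : A ⟶ B) (r : B ⟶ A) (h : i ≫ r = 𝟙 A) :
    B ≅ A ⊞ cokernel i :=
  have : Mono i := (SplitMono.mk r h).mono
  (ShortComplex.Splitting.ofExactOfRetraction (ShortComplex.mk i (cokernel.π i) (by simp))
    (ShortComplex.exact_cokernel i) r h inferInstance).isoBinaryBiproduct

lemma indec_summand {A B : RepC k Q} (i : A ⟶ B) (r : B ⟶ A) (h : i ≫ r = 𝟙 A) (hB : Indec B)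
    (hA : ¬ IsZero A) : IsIso i := by
  have : Mono i := (SplitMono.mk r h).mono
  rcases hB.2 _ _ (retIso i r h) with h1 | h1
  · exact absurd h1 hA
  · have : Epi i := by
      apply Preadditive.epi_of_cokernel_zero
      exact h1.eq_of_tgt _ _
    exact isIso_of_mono_of_epi i

lemma indec_summand' {A B : RepC k Q} (i : A ⟶ B) (r : B ⟶ A) (h : i ≫ r = 𝟙 A) (hB : Indec B)
    (hA : ¬ IsZero A) : IsIso r := by
  have := indec_summand i r h hB hA
  rw [← IsIso.inv_eq_of_hom_inv_id h] ; infer_instance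

lemma indec_iso {A B : RepC k Q} (e : A ≅ B) (h : Indec A) : Indec B :=
  ⟨fun h0 => h.1 (h0.of_iso e), fun _ _ e' => h.2 _ _ (e ≪≫ e')⟩

lemma dd_pos {X : RepC k Q} (hX : FinDim X) (h : ¬ IsZero X) : 0 < dd X :=
  Nat.pos_of_ne_zero fun h0 => h (isZero_of_dd hX h0)

/-- decomposition with a total relation -/
lemma exists_decomp (n : ℕ) : ∀ (X : RepC k Q), FinDim X → dd X ≤ n →
    ∃ (m : ℕ) (f : Fin m → RepC k Q) (ι : ∀ i, f i ⟶ X) (π : ∀ i, X ⟶ f i),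
      (∀ i, Indec (f i)) ∧ (∀ i, ι i ≫ π i = 𝟙 _) ∧ ∑ i, π i ≫ ι i = 𝟙 X := by
  induction n with
  | zero =>
    intro X hX h
    refine ⟨0, Fin.elim0, fun i => i.elim0, fun i => i.elim0, fun i => i.elim0,
      fun i => i.elim0, ?_⟩
    simp
    exact ((IsZero.iff_id_eq_zero X).1 (isZero_of_dd hX (by omega))).symm
  | succ n ih =>
    intro X hX h
    by_cases h0 : IsZero X
    · apply ih X hX
      have : dd X = 0 := Finset.sum_eq_zero fun v _ => by
        have : Subsingleton (ob X v) := ⟨fun a b => by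
          rw [← ap_id X v a, ← ap_id X v b, (IsZero.iff_id_eq_zero X).1 h0]; rfl⟩
        exact Module.finrank_zero_of_subsingleton
      omega
    by_cases hI : Indec X
    · exact ⟨1, fun _ => X, fun _ => 𝟙 X, fun _ => 𝟙 X, fun _ => hI, fun _ => by simp, by simp⟩
    · have : ∃ (A B : RepC k Q) (e : X ≅ A ⊞ B), ¬ IsZero A ∧ ¬ IsZero B := by
        by_contra hc
        push Not at hc
        exact hI ⟨h0, fun A B e => by
          by_contra hAB; push Not at hAB; exact hAB.2 (hc A B e hAB.1)⟩
      obtain ⟨A, B, e, hA, hB⟩ := this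
      have hAB : FinDim (A ⊞ B) := fd_epi e.hom hX
      have hfA : FinDim A := fd_epi (biprod.fst : A ⊞ B ⟶ A) hAB
      have hfB : FinDim B := fd_epi (biprod.snd : A ⊞ B ⟶ B) hAB
      have h1 := dd_ext (biprod_se A B) hAB
      have h2 := dd_epi e.hom hX
      have h3 := dd_pos hfA hA
      have h4 := dd_pos hfB hB
      simp only at h1
      obtain ⟨m, f, ι, π, a1, a2, a3⟩ := ih A hfA (by omega)
      obtain ⟨m', f', ι', π', b1, b2, b3⟩ := ih B hfB (by omega)
      refine ⟨m + m', Fin.append f f', 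
        Fin.addCases (fun i => eqToHom (Fin.append_left f f' i) ≫ ι i ≫ biprod.inl ≫ e.inv)
          (fun i => eqToHom (Fin.append_right f f' i) ≫ ι' i ≫ biprod.inr ≫ e.inv),
        Fin.addCases (fun i => e.hom ≫ biprod.fst ≫ π i ≫ eqToHom (Fin.append_left f f' i).symm)
          (fun i => e.hom ≫ biprod.snd ≫ π' i ≫ eqToHom (Fin.append_right f f' i).symm),
        ?_, ?_, ?_⟩
      · refine Fin.addCases (fun i => ?_) (fun i => ?_)
        · rw [Fin.append_left]; exact a1 i
        · rw [Fin.append_right]; exact b1 i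
      · refine Fin.addCases (fun i => ?_) (fun i => ?_)
        · simp [reassoc_of% (a2 i)]
        · simp [reassoc_of% (b2 i)]
      · rw [Fin.sum_univ_add]
        simp only [Fin.addCases_left, Fin.addCases_right, Category.assoc, eqToHom_trans_assoc,
          eqToHom_refl, Category.id_comp]
        have e1 : ∑ i, e.hom ≫ biprod.fst ≫ π i ≫ ι i ≫ biprod.inl ≫ e.inv =
            e.hom ≫ biprod.fst ≫ (∑ i, π i ≫ ι i) ≫ biprod.inl ≫ e.inv := by
          simp only [Preadditive.sum_comp, Preadditive.comp_sum, Category.assoc]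
        have e2 : ∑ i, e.hom ≫ biprod.snd ≫ π' i ≫ ι' i ≫ biprod.inr ≫ e.inv =
            e.hom ≫ biprod.snd ≫ (∑ i, π' i ≫ ι' i) ≫ biprod.inr ≫ e.inv := by
          simp only [Preadditive.sum_comp, Preadditive.comp_sum, Category.assoc]
        rw [e1, e2, a3, b3, Category.id_comp, Category.id_comp]
        have e3 := biprod.total (X := A) (Y := B)
        calc _ = e.hom ≫ (biprod.fst ≫ biprod.inl + biprod.snd ≫ biprod.inr) ≫ e.inv := by
              simp only [Preadditive.add_comp, Preadditive.comp_add, Category.assoc]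
          _ = 𝟙 X := by rw [e3]; simp

lemma decomp {X : RepC k Q} (hX : FinDim X) :
    ∃ (m : ℕ) (f : Fin m → RepC k Q) (ι : ∀ i, f i ⟶ X) (π : ∀ i, X ⟶ f i),
      (∀ i, Indec (f i)) ∧ (∀ i, ι i ≫ π i = 𝟙 _) ∧ ∑ i, π i ≫ ι i = 𝟙 X :=
  exists_decomp (dd X) X hX le_rfl

lemma sum_to {A X : RepC k Q} (hX : FinDim X) (f : A ⟶ X) (hf : f ≠ 0) :
    ∃ (Y : RepC k Q) (i : Y ⟶ X) (r : X ⟶ Y), FinDim Y ∧ Indec Y ∧ i ≫ r = 𝟙 Y ∧ f ≫ r ≠ 0 := by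
  obtain ⟨m, F, ι, π, h1, h2, h3⟩ := decomp hX
  by_contra hc
  push Not at hc
  apply hf
  rw [← Category.comp_id f, ← h3, Preadditive.comp_sum]
  apply Finset.sum_eq_zero
  intro i _
  have : Mono (ι i) := (SplitMono.mk _ (h2 i)).mono
  rw [← Category.assoc, hc (F i) (ι i) (π i) (fd_mono (ι i) hX) (h1 i) (h2 i), zero_comp]

lemma sum_from {A X : RepC k Q} (hX : FinDim X) (f : X ⟶ A) (hf : f ≠ 0) :
    ∃ (Y : RepC k Q) (i : Y ⟶ X) (r : X ⟶ Y), FinDim Y ∧ Indec Y ∧ i ≫ r = 𝟙 Y ∧ i ≫ f ≠ 0 := by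
  obtain ⟨m, F, ι, π, h1, h2, h3⟩ := decomp hX
  by_contra hc
  push Not at hc
  apply hf
  rw [← Category.id_comp f, ← h3, Preadditive.sum_comp]
  apply Finset.sum_eq_zero
  intro i _
  have : Mono (ι i) := (SplitMono.mk _ (h2 i)).mono
  rw [Category.assoc, hc (F i) (ι i) (π i) (fd_mono (ι i) hX) (h1 i) (h2 i), comp_zero]

lemma mem_iso {T : Set (RepC k Q)} (hT : Tors T) {X Y : RepC k Q} (e : X ≅ Y) (h : X ∈ T) : Y ∈ T :=
  hT.1.quot_mem X h Y e.hom inferInstance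

lemma zero_mem {T : Set (RepC k Q)} (hT : Tors T) {X : RepC k Q} (h : IsZero X) : X ∈ T :=
  mem_iso hT ((isZero_zero _).iso h) hT.1.zero_mem

lemma sum_mem {T : Set (RepC k Q)} (hT : Tors T) (n : ℕ) : ∀ f : Fin n → RepC k Q, 
    (∀ i, f i ∈ T) → ∀ (Y : RepC k Q) (ι : ∀ i, f i ⟶ Y) (π : ∀ i, Y ⟶ f i),
      ∑ i, π i ≫ ι i = 𝟙 Y → Y ∈ T := by
  have key : ∀ (n : ℕ) (f : Fin n → RepC k Q), (∀ i, f i ∈ T) →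
      ∃ B ∈ T, ∃ ι : ∀ i, f i ⟶ B, ∃ π : ∀ i, B ⟶ f i, (∀ i, ι i ≫ π i = 𝟙 _) ∧
        ∀ i j, i ≠ j → ι i ≫ π j = 0 := by
    intro n
    induction n with
    | zero => exact fun f _ => ⟨0, hT.1.zero_mem, fun i => i.elim0, fun i => i.elim0,
        fun i => i.elim0, fun i => i.elim0⟩
    | succ n ih =>
      intro f hf
      obtain ⟨B, hB, ι, π, h1, h2⟩ := ih (fun i => f i.succ) (fun i => hf _)
      refine ⟨f 0 ⊞ B, hT.1.sum_mem _ (hf 0) _ hB, Fin.cons biprod.inl (fun i => ι i ≫ biprod.inr),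
        Fin.cons biprod.fst (fun i => biprod.snd ≫ π i), ?_, ?_⟩
      · refine Fin.cases ?_ (fun i => ?_)
        · simp
        · simp [h1]
      · refine Fin.cases (fun j hj => ?_) (fun i j hj => ?_)
        · cases j using Fin.cases with
          | zero => exact absurd rfl hj
          | succ j => simp
        · cases j using Fin.cases with
          | zero => simp
          | succ j => simp [h2 i j (fun h => hj (by rw [h]))]
  intro f hf Y ι π hs
  obtain ⟨B, hB, ι', π', h1, h2⟩ := key n f hf
  refine hT.1.summand_mem B hB Y ⟨∑ i, π i ≫ ι' i, ∑ i, π' i ≫ ι i, ?_⟩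
  rw [Preadditive.sum_comp, ← hs]
  apply Finset.sum_congr rfl
  intro i _
  rw [Preadditive.comp_sum, Finset.sum_eq_single i]
  · rw [Category.assoc, reassoc_of% (h1 i)]
  · intro j _ hj
    rw [Category.assoc, reassoc_of% (h2 i j hj.symm)]; simp
  · simp

lemma mem_of_indec {T : Set (RepC k Q)} (hT : Tors T) {X : RepC k Q} (hX : FinDim X)
    (h : ∀ (Y : RepC k Q) (i : Y ⟶ X) (r : X ⟶ Y), FinDim Y → Indec Y → i ≫ r = 𝟙 Y → Y ∈ T) :
    X ∈ T := by
  obtain ⟨m, F, ι, π, h1, h2, h3⟩ := decomp hX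
  refine sum_mem hT m F (fun i => ?_) X ι π h3
  have : Mono (ι i) := (SplitMono.mk _ (h2 i)).mono
  exact h (F i) (ι i) (π i) (fd_mono (ι i) hX) (h1 i) (h2 i)

lemma exists_indec {X : RepC k Q} (hX : FinDim X) (h : ¬ IsZero X) :
    ∃ (Y : RepC k Q) (i : Y ⟶ X) (r : X ⟶ Y), FinDim Y ∧ Indec Y ∧ i ≫ r = 𝟙 Y := by
  obtain ⟨Y, i, r, a, b, c, _⟩ := sum_to hX (𝟙 X) (fun h' => h ((IsZero.iff_id_eq_zero X).2 h'))
  exact ⟨Y, i, r, a, b, c⟩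

end Bas

section Bricks
variable {k : Type} [Field k] {Q : FinQuiver}

lemma ker_comp_mem {T : Set (RepC k Q)} (hT : Tors T) {X Y Z : RepC k Q} (f : X ⟶ Y) (g : Y ⟶ Z)
    [Epi f] (h1 : kernel f ∈ T) (h2 : kernel g ∈ T) : kernel (f ≫ g) ∈ T := by
  let S := kernelCokernelCompSequence.snakeInput f g
  have hz : IsZero S.L₃.X₁ := by
    change IsZero (cokernel f)
    exact isZero_cokernel_of_epi f
  have e1 : Epi S.L₀.g := S.L₁'_exact.epi_f (hz.eq_of_tgt _ _)
  have e2 : Mono S.L₀.f := by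
    change Mono (kernel.map f (f ≫ g) (𝟙 _) g (by simp))
    infer_instance
  have := hT.1.ext_mem S.L₀ ⟨S.L₀_exact⟩ h1 h2
  exact this

lemma image_epi_mem {T : Set (RepC k Q)} (hT : Tors T) {X Y : RepC k Q} (f : X ⟶ Y)
    (h : X ∈ T) : kernel (cokernel.π f) ∈ T :=
  hT.1.quot_mem X h _ (Abelian.factorThruImage f) inferInstance

lemma torsion_quot {T : Set (RepC k Q)} (hT : Tors T) {X : RepC k Q} (hX : FinDim X) :
    ∃ (G : RepC k Q) (q : X ⟶ G), Epi q ∧ FinDim G ∧ kernel q ∈ T ∧ ∀ B ∈ T, HomZero B G := by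
  classical
  have hex : ∃ n, ∃ (G : RepC k Q) (q : X ⟶ G), Epi q ∧ kernel q ∈ T ∧ dd G = n :=
    ⟨_, X, 𝟙 X, inferInstance, zero_mem hT (by
      exact (isZero_zero _).of_iso (kernel.ofMono (𝟙 X))), rfl⟩
  obtain ⟨G, q, hq, hk, hd⟩ := Nat.find_spec hex
  have hG := fd_epi q hX
  refine ⟨G, q, hq, hG, hk, fun B hB f => ?_⟩
  have h1 : kernel (q ≫ cokernel.π f) ∈ T := ker_comp_mem hT q _ hk (image_epi_mem hT f hB)
  have h2 := Nat.find_min' hex ⟨_, q ≫ cokernel.π f, epi_comp _ _, h1, rfl⟩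
  have h3 : IsIso (cokernel.π f) := iso_of_epi _ hG (by omega)
  have h4 := cokernel.condition f
  rwa [← cancel_mono (cokernel.π f), zero_comp]

lemma endo_iso {X : RepC k Q} (hX : FinDim X) (hI : Indec X)
    (ih : ∀ Y : RepC k Q, FinDim Y → Indec Y → dd Y < dd X → E0 Y Y) (θ : X ⟶ X) (hθ : θ ≠ 0) :
    IsIso θ := by
  classical
  by_contra hni
  have hex : ∃ n, ∃ (I : RepC k Q) (e : X ⟶ I) (m : I ⟶ X), Epi e ∧ Mono m ∧ e ≫ m ≠ 0 ∧
      ¬ IsIso (e ≫ m) ∧ dd I = n :=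
    ⟨_, image θ, factorThruImage θ, image.ι θ, inferInstance, inferInstance, by simpa using hθ,
      by simpa using hni, rfl⟩
  obtain ⟨I, e, m, he, hm, hem, hnem, hd⟩ := Nat.find_spec hex
  have hmin := fun n h => Nat.find_min' hex (m := n) h
  rw [← hd] at hmin
  have hfI : FinDim I := fd_epi e hX
  have hI0 : ¬ IsZero I := fun h0 => hem (by rw [h0.eq_of_tgt e 0, zero_comp])
  have hu : m ≫ e = 0 := by
    by_contra hu
    by_cases hi : IsIso (m ≫ e)
    · have h1 : IsIso m := indec_summand m (e ≫ inv (m ≫ e)) (by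
        rw [← Category.assoc, IsIso.hom_inv_id]) hI hI0
      have h2 : IsIso e := IsIso.of_isIso_comp_left m e
      exact hnem inferInstance
    · have h1 := hmin _ ⟨image (m ≫ e), e ≫ factorThruImage (m ≫ e), image.ι (m ≫ e) ≫ m,
        epi_comp _ _, mono_comp _ _, ?_, ?_, rfl⟩
      · have h2 : IsIso (image.ι (m ≫ e)) := iso_of_mono _ hfI h1
        have h3 : IsIso (factorThruImage (m ≫ e)) := iso_of_epi _ hfI h1
        apply hi
        rw [← image.fac (m ≫ e)]; infer_instance
      · have : (e ≫ factorThruImage (m ≫ e)) ≫ image.ι (m ≫ e) ≫ m = e ≫ (m ≫ e) ≫ m := by simp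
        rw [this]
        intro h
        have h' := (cancel_epi e).1 (h.trans comp_zero.symm)
        exact hu ((cancel_mono m).1 (h'.trans zero_comp.symm))
      · have : (e ≫ factorThruImage (m ≫ e)) ≫ image.ι (m ≫ e) ≫ m = (e ≫ m) ≫ (e ≫ m) := by simp
        rw [this]
        intro h
        have h1 : Mono (e ≫ m) := mono_of_mono _ (e ≫ m)
        have h2 : Epi (e ≫ m) := epi_of_epi (e ≫ m) _
        exact hnem (isIso_of_mono_of_epi _)
  have hm' : kernel.lift e m hu ≠ 0 := by
    intro h
    have := kernel.lift_ι e m hu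
    rw [h, zero_comp] at this
    exact hem (by rw [← this, comp_zero])
  have hK : FinDim (kernel e) := fd_mono (kernel.ι e) hX
  obtain ⟨Y, i, r, hY, hYI, hir, hne⟩ := sum_to hK _ hm'
  have hmi : Mono i := (SplitMono.mk r hir).mono
  set w := kernel.lift e m hu ≫ r with hw
  have h1 := hmin _ ⟨image w, e ≫ factorThruImage w, image.ι w ≫ i ≫ kernel.ι e,
        epi_comp _ _, inferInstance, ?_, ?_, rfl⟩
  · have h3 : IsIso (factorThruImage w) := iso_of_epi _ hfI h1
    have hmw : Mono w := by rw [← image.fac w]; infer_instance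
    have hdd := dd_ext (ker_se e) hX
    simp only at hdd
    have h4 := dd_pos hfI hI0
    have h5 := dd_mono i hK
    have hE := (ih Y hY hYI (by omega)).sub w
    obtain ⟨g, hg⟩ := E0.extend (ker_se e) hE r
    simp only at g hg
    have h6 : IsIso (i ≫ kernel.ι e) := indec_summand (i ≫ kernel.ι e) g (by
      rw [Category.assoc, hg, hir]) hI hYI.1
    have h7 := dd_epi (i ≫ kernel.ι e) hY
    omega
  · have : (e ≫ factorThruImage w) ≫ image.ι w ≫ i ≫ kernel.ι e = e ≫ w ≫ i ≫ kernel.ι e := by simp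
    rw [this]
    intro h
    have h' := (cancel_epi e).1 (h.trans comp_zero.symm)
    exact hne ((cancel_mono (i ≫ kernel.ι e)).1 (h'.trans zero_comp.symm))
  · intro h
    have h1 : Epi (((e ≫ factorThruImage w) ≫ image.ι w ≫ i) ≫ kernel.ι e) := by
      have : ((e ≫ factorThruImage w) ≫ image.ι w ≫ i) ≫ kernel.ι e =
        (e ≫ factorThruImage w) ≫ image.ι w ≫ i ≫ kernel.ι e := by simp
      rw [this]; infer_instance
    have h2 : Epi (kernel.ι e) := epi_of_epi ((e ≫ factorThruImage w) ≫ image.ι w ≫ i) (kernel.ι e)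
    have h3 : e = 0 := (cancel_epi (kernel.ι e)).1 (by simp)
    exact hem (by rw [h3, zero_comp])

lemma endo_scalar [IsAlgClosed k] {X : RepC k Q} (hX : FinDim X) (h0 : ¬ IsZero X)
    (h : ∀ θ : X ⟶ X, θ ≠ 0 → IsIso θ) (f : X ⟶ X) : ∃ c : k, c • 𝟙 X = f := by
  have : ∃ v, Nontrivial (ob X v) := by
    by_contra hc
    push Not at hc
    apply h0
    rw [IsZero.iff_id_eq_zero]
    apply hom_ext'
    intro v
    ext x
    have := hc v
    exact Subsingleton.elim _ _
  obtain ⟨v, hv⟩ := this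
  have : FiniteDimensional k (ob X v) := hX v
  obtain ⟨c, hc⟩ := Module.End.exists_eigenvalue (ap f v)
  obtain ⟨x, hx⟩ := hc.exists_hasEigenvector
  refine ⟨c, ?_⟩
  by_contra hne
  have hi := h (f - c • 𝟙 X) (fun h => hne (sub_eq_zero.1 h).symm)
  have hinj := (mono_iff (f - c • 𝟙 X)).1 inferInstance v
  apply hx.2
  apply hinj
  rw [map_zero, ap_sub, ap_smul, LinearMap.sub_apply, LinearMap.smul_apply, ap_id, hx.apply_eq_smul, sub_self]

lemma brick_aux [IsAlgClosed k] (hft : FiniteType Q) (n : ℕ) : ∀ X : RepC k Q, FinDim X → Indec X →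
    dd X ≤ n → (∀ f : X ⟶ X, ∃ c : k, c • 𝟙 X = f) ∧ E0 X X ∧ euler Q (dimVec X) (dimVec X) = 1 := by
  induction n with
  | zero =>
    intro X hX hI h
    have := dd_pos hX hI.1
    omega
  | succ n ih =>
    intro X hX hI h
    have h1 := endo_scalar hX hI.1 (endo_iso hX hI fun Y hY hYI hd => (ih Y hY hYI (by omega)).2.1)
    have hid : 𝟙 X ≠ 0 := fun h => hI.1 ((IsZero.iff_id_eq_zero X).2 h)
    have h2 : Module.finrank k (X ⟶ X) = 1 := (finrank_eq_one_iff_of_nonzero' (𝟙 X) hid).2 h1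
    have h3 := euler_le hX hX
    have h4 := euler_pos hft _ (dimVec_ne hX hI.1)
    rw [h2] at h3
    have h5 : euler Q (dimVec X) (dimVec X) = 1 := by
      apply le_antisymm _ h4
      exact_mod_cast h3
    exact ⟨h1, (E0_iff_euler hX hX).2 (by rw [h5, h2]; rfl), h5⟩

section
variable [IsAlgClosed k] (hft : FiniteType Q) {X : RepC k Q} (hX : FinDim X) (hI : Indec X)
include hft hX hI
lemma br_scalar (f : X ⟶ X) : ∃ c : k, c • 𝟙 X = f := (brick_aux hft _ X hX hI le_rfl).1 f
lemma br_E0 : E0 X X := (brick_aux hft _ X hX hI le_rfl).2.1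
lemma br_euler : euler Q (dimVec X) (dimVec X) = 1 := (brick_aux hft _ X hX hI le_rfl).2.2
lemma br_iso (f : X ⟶ X) (hf : f ≠ 0) : IsIso f := 
  endo_iso hX hI (fun Y hY hYI _ => br_E0 hft hY hYI) f hf
end

lemma dimVec_nonneg (X : RepC k Q) (v : Q.V) : 0 ≤ dimVec X v := Int.natCast_nonneg _

lemma hom_pos {X Y : RepC k Q} (hX : FinDim X) (hY : FinDim Y) (hE : E0 X Y) (f : X ⟶ Y)
    (hf : f ≠ 0) : 1 ≤ euler Q (dimVec X) (dimVec Y) := by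
  rw [(E0_iff_euler hX hY).1 hE]
  have := hom_finite hX hY
  have : Nontrivial (X ⟶ Y) := ⟨f, 0, hf⟩
  exact_mod_cast Module.finrank_pos

lemma exists_hom {X Y : RepC k Q} (hX : FinDim X) (hY : FinDim Y)
    (h : 1 ≤ euler Q (dimVec X) (dimVec Y)) : ∃ f : X ⟶ Y, f ≠ 0 := by
  have h1 := h.trans (euler_le hX hY)
  have h2 : 0 < Module.finrank k (X ⟶ Y) := by exact_mod_cast h1
  have := Module.nontrivial_of_finrank_pos h2
  exact exists_ne 0

/-- factor a nonzero map through an indecomposable-quotient / subobject -/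
lemma factor [IsAlgClosed k] (hft : FiniteType Q) {X Y : RepC k Q} (hX : FinDim X) (hY : FinDim Y) 
    (hXI : Indec X) (hYI : Indec Y) (f : X ⟶ Y) (hf : f ≠ 0) :
    ∃ (J : RepC k Q) (p : X ⟶ J) (j : J ⟶ Y), FinDim J ∧ Indec J ∧ Epi p ∧ Mono j ∧
      1 ≤ euler Q (dimVec X) (dimVec J) ∧ 1 ≤ euler Q (dimVec J) (dimVec Y) := by
  have hfi : FinDim (image f) := fd_mono (image.ι f) hY
  have hi0 : ¬ IsZero (image f) := fun h => hf (by
    rw [← image.fac f, h.eq_of_tgt (factorThruImage f) 0, zero_comp])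
  obtain ⟨J, i, r, hJ, hJI, hir⟩ := exists_indec hfi hi0
  have hmi : Mono i := (SplitMono.mk r hir).mono
  have her : Epi r := (SplitEpi.mk i hir).epi
  have hid : 𝟙 J ≠ 0 := fun h => hJI.1 ((IsZero.iff_id_eq_zero J).2 h)
  refine ⟨J, factorThruImage f ≫ r, i ≫ image.ι f, hJ, hJI, epi_comp _ _, mono_comp _ _, ?_, ?_⟩
  · refine hom_pos hX hJ ((br_E0 hft hX hXI).quot (factorThruImage f ≫ r)) (factorThruImage f ≫ r) ?_
    intro h
    exact hid ((cancel_epi (factorThruImage f ≫ r)).1 (by rw [h]; simp))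
  · refine hom_pos hJ hY ((br_E0 hft hY hYI).sub (i ≫ image.ι f)) (i ≫ image.ι f) ?_
    intro h
    exact hid ((cancel_mono (i ≫ image.ι f)).1 (by rw [h]; simp))

lemma iso_of_dim [IsAlgClosed k] (hft : FiniteType Q) {X Y : RepC k Q} (hX : FinDim X)
    (hY : FinDim Y) (hXI : Indec X) (hYI : Indec Y) {g : (Q.V → ℤ) → ℕ}
    (hg : ∀ x y, (∀ v, 0 ≤ x v) → (∀ v, 0 ≤ y v) → euler Q x x = 1 → euler Q y y = 1 →
      (g x = g y → x = y) ∧ (1 ≤ euler Q x y → g x ≤ g y))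
    (h : g (dimVec X) = g (dimVec Y)) : Nonempty (X ≅ Y) := by
  have h1 := (hg _ _ (dimVec_nonneg X) (dimVec_nonneg Y) (br_euler hft hX hXI) (br_euler hft hY hYI)).1 h
  obtain ⟨f, hf⟩ := exists_hom (X := X) (Y := Y) hX hY (by rw [← h1, br_euler hft hX hXI])
  obtain ⟨J, p, j, hJ, hJI, hp, hj, e1, e2⟩ := factor hft hX hY hXI hYI f hf
  have a1 := (hg _ _ (dimVec_nonneg X) (dimVec_nonneg J) (br_euler hft hX hXI) (br_euler hft hJ hJI)).2 e1
  have a2 := (hg _ _ (dimVec_nonneg J) (dimVec_nonneg Y) (br_euler hft hJ hJI) (br_euler hft hY hYI)).2 e2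
  have a3 := (hg _ _ (dimVec_nonneg X) (dimVec_nonneg J) (br_euler hft hX hXI) (br_euler hft hJ hJI)).1 (by omega)
  have b1 : IsIso p := iso_of_epi p hX (dd_eq a3).le
  have b2 : IsIso j := iso_of_mono j hY (by rw [← dd_eq a3, dd_eq h1])
  exact ⟨asIso p ≪≫ asIso j⟩

lemma exists_psi (k : Type) [Field k] [IsAlgClosed k] (Q : FinQuiver) (hft : FiniteType Q) :
    ∃ (N : ℕ) (ψ : RepC k Q → ℕ),
    (∀ X, FinDim X → Indec X → ψ X < N) ∧ (∀ i < N, ∃ X, FinDim X ∧ Indec X ∧ ψ X = i) ∧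
    (∀ X Y, FinDim X → FinDim Y → Indec X → Indec Y → ψ X = ψ Y → Nonempty (X ≅ Y)) ∧
    (∀ X Y (f : X ⟶ Y), FinDim X → FinDim Y → Indec X → Indec Y → f ≠ 0 → ψ Y ≤ ψ X) := by
  classical
  obtain ⟨g, hg⟩ := exists_rootorder hft
  let S : Set ℕ := {n | ∃ X : RepC k Q, FinDim X ∧ Indec X ∧ g (dimVec X) = n}
  have hS : S.Finite := by
    refine ((roots_finite hft).image g).subset ?_
    rintro n ⟨X, hX, hI, rfl⟩
    exact ⟨dimVec X, br_euler hft hX hI, rfl⟩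
  let F := hS.toFinset
  have hF : ∀ n, n ∈ F ↔ n ∈ S := fun n => hS.mem_toFinset
  let c : ℕ → ℕ := fun m => (F.filter (fun s => m < s)).card
  have hc : ∀ m m', m ≤ m' → c m' ≤ c m := fun m m' h => Finset.card_le_card (by
    intro s; simp only [Finset.mem_filter]; exact fun hs => ⟨hs.1, by omega⟩)
  have hc' : ∀ m m', m < m' → m' ∈ F → c m' < c m := fun m m' h hm' => Finset.card_lt_card (by
    rw [Finset.ssubset_iff_of_subset]
    · exact ⟨m', by simp [hm', h], by simp⟩
    · intro s; simp only [Finset.mem_filter]; exact fun hs => ⟨hs.1, by omega⟩)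
  have hlt : ∀ m ∈ F, c m < F.card := fun m hm => Finset.card_lt_card (by
    rw [Finset.ssubset_iff_of_subset (Finset.filter_subset _ _)]
    exact ⟨m, hm, by simp⟩)
  have hinj : Set.InjOn c F := by
    intro a ha b hb hab
    rcases lt_trichotomy a b with h | h | h
    · exact absurd hab (hc' _ _ h hb).ne'
    · exact h
    · exact absurd hab (hc' _ _ h ha).ne
  have hsurj : ∀ i < F.card, ∃ m ∈ F, c m = i := by
    intro i hi
    have h := Finset.surj_on_of_inj_on_of_card_le (s := F) (t := Finset.range F.card)
      (fun a _ => c a) (fun a ha => Finset.mem_range.2 (hlt a ha))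
      (fun a b ha hb h => hinj ha hb h) (by simp) i (Finset.mem_range.2 hi)
    obtain ⟨a, ha, h⟩ := h
    exact ⟨a, ha, h.symm⟩
  have hmem : ∀ X : RepC k Q, FinDim X → Indec X → g (dimVec X) ∈ F := fun X hX hI =>
    (hF _).2 ⟨X, hX, hI, rfl⟩
  refine ⟨F.card, fun X => c (g (dimVec X)), ?_, ?_, ?_, ?_⟩
  · intro X hX hI
    exact hlt _ (hmem X hX hI)
  · intro i hi
    obtain ⟨m, hm, h⟩ := hsurj i hi
    obtain ⟨X, hX, hI, h'⟩ := (hF m).1 hm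
    exact ⟨X, hX, hI, by change c (g _) = i; rw [h', h]⟩
  · intro X Y hX hY hXI hYI h
    exact iso_of_dim hft hX hY hXI hYI hg (hinj (hmem X hX hXI) (hmem Y hY hYI) h)
  · intro X Y f hX hY hXI hYI hf
    obtain ⟨J, p, j, hJ, hJI, hp, hj, e1, e2⟩ := factor hft hX hY hXI hYI f hf
    have a1 := (hg _ _ (dimVec_nonneg X) (dimVec_nonneg J) (br_euler hft hX hXI) (br_euler hft hJ hJI)).2 e1
    have a2 := (hg _ _ (dimVec_nonneg J) (dimVec_nonneg Y) (br_euler hft hJ hJI) (br_euler hft hY hYI)).2 e2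
    exact hc _ _ (a1.trans a2)

end Bricks

section Lat
variable {k : Type} [Field k] {Q : FinQuiver}

lemma tors_sInter {𝒰 : Set (Set (RepC k Q))} (h : ∀ U ∈ 𝒰, Tors U) (hne : 𝒰.Nonempty) :
    Tors (⋂₀ 𝒰) where
  left :=
    { zero_mem := fun U hU => (h U hU).1.zero_mem
      sum_mem := fun X hX Y hY U hU => (h U hU).1.sum_mem X (hX U hU) Y (hY U hU)
      summand_mem := fun X hX Y hY U hU => (h U hU).1.summand_mem X (hX U hU) Y hY
      quot_mem := fun X hX Y p hp U hU => (h U hU).1.quot_mem X (hX U hU) Y p hp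
      ext_mem := fun S hS h1 h3 U hU => (h U hU).1.ext_mem S hS (h1 U hU) (h3 U hU) }
  right := fun X hX => (h _ hne.choose_spec).2 X (hX _ hne.choose_spec)

lemma tors_inter (T₁ T₂ : Set (RepC k Q)) (h1 : Tors T₁) (h2 : Tors T₂) : Tors (T₁ ∩ T₂) := by
  rw [← Set.sInter_pair]
  refine tors_sInter ?_ ⟨T₁, by simp⟩
  rintro U (rfl | rfl)
  · exact h1
  · exact h2

lemma tors_tjoin {T₁ T₂ : Set (RepC k Q)} (h1 : Tors T₁) (h2 : Tors T₂) : Tors (tjoin k Q T₁ T₂) :=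
  tors_sInter (fun _ hU => hU.1) ⟨_, tors_fd, h1.2, h2.2⟩

lemma tjoin_le {T₁ T₂ U : Set (RepC k Q)} (hU : Tors U) (h1 : T₁ ⊆ U) (h2 : T₂ ⊆ U) :
    tjoin k Q T₁ T₂ ⊆ U := Set.sInter_subset_of_mem ⟨hU, h1, h2⟩

lemma le_tjoin_left (T₁ T₂ : Set (RepC k Q)) : T₁ ⊆ tjoin k Q T₁ T₂ :=
  Set.subset_sInter fun _ hU => hU.2.1

lemma le_tjoin_right (T₁ T₂ : Set (RepC k Q)) : T₂ ⊆ tjoin k Q T₁ T₂ :=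
  Set.subset_sInter fun _ hU => hU.2.2

def perp (M : RepC k Q) : Set (RepC k Q) := {X | FinDim X ∧ HomZero X M}

lemma tors_perp (M : RepC k Q) : Tors (perp M) where
  left :=
    { zero_mem := ⟨tors_fd.1.zero_mem, fun f => (isZero_zero _).eq_of_src _ _⟩
      sum_mem := fun X hX Y hY => ⟨tors_fd.1.sum_mem X hX.1 Y hY.1, fun f => by
        apply biprod.hom_ext'
        · rw [hX.2 (biprod.inl ≫ f), comp_zero]
        · rw [hY.2 (biprod.inr ≫ f), comp_zero]⟩
      summand_mem := fun X hX Y hY => ⟨tors_fd.1.summand_mem X hX.1 Y hY, fun f => by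
        obtain ⟨i, r, h⟩ := hY
        rw [← Category.id_comp f, ← h, Category.assoc, hX.2 (r ≫ f), comp_zero]⟩
      quot_mem := fun X hX Y p hp => ⟨tors_fd.1.quot_mem X hX.1 Y p hp, fun f => by
        rw [← cancel_epi p, comp_zero, hX.2 (p ≫ f)]⟩
      ext_mem := fun S hS h1 h3 => ⟨tors_fd.1.ext_mem S hS h1.1 h3.1, fun f => by
        have := hS.epi_g
        rw [← hS.exact.g_desc f (h1.2 _), h3.2 (hS.exact.desc f _), comp_zero]⟩ }
  right := fun _ hX => hX.1

lemma tors_zero : Tors {X : RepC k Q | IsZero X} where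
  left :=
    { zero_mem := isZero_zero _
      sum_mem := fun X hX Y hY => (biprod_isZero_iff X Y).2 ⟨hX, hY⟩
      summand_mem := fun X hX Y hY => by
        obtain ⟨i, r, h⟩ := hY
        refine (IsZero.iff_id_eq_zero Y).2 ?_
        rw [← h, IsZero.eq_of_tgt hX i 0, zero_comp]
      quot_mem := fun X hX Y p hp => IsZero.of_epi p hX
      ext_mem := fun S hS h1 h3 => hS.exact.isZero_of_both_zeros
        (IsZero.eq_of_src h1 _ _) (IsZero.eq_of_tgt h3 _ _) }
  right := fun _ hX => fd_zero hX

lemma mem_gen {M : RepC k Q} (hM : FinDim M) (X : RepC k Q) : X ∈ gen ({M} : Set (RepC k Q)) ↔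
    FinDim X ∧ ∀ (Z : RepC k Q) (g : X ⟶ Z), (∀ f : M ⟶ X, f ≫ g = 0) → g = 0 := by
  constructor
  · rintro ⟨A, ⟨n, F, hF, i, r, hir⟩, p, hp⟩
    obtain rfl : F = fun _ => M := funext hF
    have hi : Mono i := (SplitMono.mk r hir).mono
    have hr : Epi r := (SplitEpi.mk i hir).epi
    refine ⟨fd_epi p (fd_mono i (fd_sum _ fun _ => hM)), fun Z g hg => ?_⟩
    rw [← cancel_epi p, ← cancel_epi r, comp_zero, comp_zero]
    apply biproduct.hom_ext'
    intro j
    have := hg (biproduct.ι (fun _ : Fin n => M) j ≫ r ≫ p)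
    simp only [Category.assoc] at this
    rw [this, comp_zero]
  · rintro ⟨hX, h⟩
    have := hom_finite hM hX
    let b := Module.finBasis k (M ⟶ X)
    refine ⟨⨁ (fun _ : Fin (Module.finrank k (M ⟶ X)) => M), ⟨_, _, fun _ => rfl, 𝟙 _, 𝟙 _, by simp⟩,
      biproduct.desc (fun i => b i), ?_⟩
    apply Preadditive.epi_of_cancel_zero
    intro Z g hg
    apply h
    intro f
    have hb : ∀ i, b i ≫ g = 0 := fun i => by
      have := congrArg (fun t => biproduct.ι _ i ≫ t) hg
      simpa using this
    rw [← b.sum_repr f, Preadditive.sum_comp]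
    apply Finset.sum_eq_zero
    intro i _
    rw [Linear.smul_comp, hb, smul_zero]

lemma self_mem_gen (M : RepC k Q) : M ∈ gen ({M} : Set (RepC k Q)) :=
  ⟨⨁ (fun _ : Fin 1 => M), ⟨1, fun _ => M, fun _ => rfl, 𝟙 _, 𝟙 _, by simp⟩,
    biproduct.π _ 0, inferInstance⟩

lemma gen_le {T : Set (RepC k Q)} (hT : Tors T) {M : RepC k Q} (hM : M ∈ T) :
    gen ({M} : Set (RepC k Q)) ⊆ T := by
  rintro X ⟨A, ⟨n, F, hF, hA⟩, p, hp⟩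
  refine hT.1.quot_mem A (hT.1.summand_mem (⨁ F) ?_ A hA) X p hp
  refine sum_mem hT n F (fun i => ?_) _ (fun i => biproduct.ι F i) (fun i => biproduct.π F i)
    biproduct.total
  rw [show F i = M from hF i]; exact hM

lemma E0_gen {M X : RepC k Q} (hE : E0 M M) (hX : X ∈ gen ({M} : Set (RepC k Q))) : E0 M X := by
  obtain ⟨A, ⟨n, F, hF, i, r, hir⟩, p, hp⟩ := hX
  obtain rfl : F = fun _ => M := funext hF
  have hr : Epi r := (SplitEpi.mk i hir).epi
  have h1 : E0 M (⨁ fun _ : Fin n => M) := E0.bip (fun _ => M)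
    (fun i => biproduct.ι (fun _ : Fin n => M) i) (fun i => biproduct.π (fun _ : Fin n => M) i) biproduct.total (fun _ => hE)
  exact (h1.quot r).quot p

lemma tors_gen {M : RepC k Q} (hM : FinDim M) (hE : E0 M M) : Tors (gen ({M} : Set (RepC k Q))) := by
  have hq : ∀ X ∈ gen ({M} : Set (RepC k Q)), ∀ (Y : RepC k Q) (p : X ⟶ Y), Epi p →
      Y ∈ gen ({M} : Set (RepC k Q)) := by
    rintro X ⟨A, hA, q, hq⟩ Y p hp
    exact ⟨A, hA, q ≫ p, epi_comp _ _⟩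
  refine ⟨⟨?_, ?_, ?_, hq, ?_⟩, fun X hX => ((mem_gen hM X).1 hX).1⟩
  · exact (mem_gen hM _).2 ⟨tors_fd.1.zero_mem, fun Z g _ => (isZero_zero _).eq_of_src _ _⟩
  · intro X hX Y hY
    rw [mem_gen hM] at hX hY ⊢
    refine ⟨tors_fd.1.sum_mem X hX.1 Y hY.1, fun Z g hg => ?_⟩
    apply biprod.hom_ext'
    · rw [comp_zero]
      exact hX.2 _ _ fun f => by rw [← Category.assoc, hg]
    · rw [comp_zero]
      exact hY.2 _ _ fun f => by rw [← Category.assoc, hg]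
  · rintro X hX Y ⟨i, r, hir⟩
    exact hq X hX Y r (SplitEpi.mk i hir).epi
  · intro S hS h1 h3
    have hE1 := E0_gen hE h1
    rw [mem_gen hM] at h1 h3 ⊢
    refine ⟨tors_fd.1.ext_mem S hS h1.1 h3.1, fun Z g hg => ?_⟩
    have := hS.epi_g
    have e1 : S.f ≫ g = 0 := h1.2 _ _ fun f => by rw [← Category.assoc, hg]
    rw [← hS.exact.g_desc g e1]
    have : hS.exact.desc g e1 = 0 := by
      apply h3.2
      intro f
      obtain ⟨f', hf'⟩ := E0.lift hS hE1 f
      rw [← hf', Category.assoc, hS.exact.g_desc, hg]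
    rw [this, comp_zero]

lemma id_ne {X : RepC k Q} (h : ¬ IsZero X) : 𝟙 X ≠ 0 := fun h' => h ((IsZero.iff_id_eq_zero X).2 h')

lemma hom_of_mem_gen {M X : RepC k Q} (hM : FinDim M) (hX : X ∈ gen ({M} : Set (RepC k Q)))
    (h0 : ¬ IsZero X) : ∃ f : M ⟶ X, f ≠ 0 := by
  by_contra hc
  push Not at hc
  exact id_ne h0 (((mem_gen hM X).1 hX).2 X (𝟙 X) fun f => by rw [hc f, zero_comp])

lemma mem_perp_iso {M M' X : RepC k Q} (e : M ≅ M') (h : X ∈ perp M) : X ∈ perp M' :=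
  ⟨h.1, fun f => by rw [← cancel_mono e.inv, zero_comp]; exact h.2 _⟩

section main
variable [IsAlgClosed k] (hft : FiniteType Q)
include hft

lemma gen_ji {M : RepC k Q} (hM : FinDim M) (hI : Indec M) : JoinIrred (gen ({M} : Set (RepC k Q))) := by
  have hG := tors_gen hM (br_E0 hft hM hI)
  refine ⟨hG, ⟨M, self_mem_gen M, hI.1⟩, fun T₁ T₂ h1 h2 h => ?_⟩
  have claim : ∀ T : Set (RepC k Q), Tors T → T ⊆ gen ({M} : Set (RepC k Q)) →
      gen ({M} : Set (RepC k Q)) ≠ T → T ⊆ perp M := by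
    intro T hT hle hne X hX
    refine ⟨hT.2 X hX, fun f => ?_⟩
    by_contra hf
    apply hne
    refine Set.Subset.antisymm (gen_le hT ?_) hle
    have := ((mem_gen hM X).1 (hle hX)).2 M f
    have : ∃ g : M ⟶ X, g ≫ f ≠ 0 := by
      by_contra hc
      push Not at hc
      exact hf (this hc)
    obtain ⟨g, hg⟩ := this
    have := br_iso hft hM hI _ hg
    exact hT.1.quot_mem X hX M f (epi_of_epi g f)
  by_contra hc
  push Not at hc
  have a1 := claim T₁ h1 (by rw [h]; exact le_tjoin_left _ _) hc.1
  have a2 := claim T₂ h2 (by rw [h]; exact le_tjoin_right _ _) hc.2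
  have a3 := tjoin_le (tors_perp M) a1 a2
  rw [← h] at a3
  exact id_ne hI.1 ((a3 (self_mem_gen M)).2 _)

lemma perp_big {M : RepC k Q} (hM : FinDim M) (hI : Indec M) {T : Set (RepC k Q)} (hT : Tors T)
    (hle : perp M ⊆ T) (hne : perp M ≠ T) : M ∈ T := by
  obtain ⟨G, q, hq, hG, hk, hz⟩ := torsion_quot hT hM
  have h0 : kernel.ι q ≠ 0 := by
    intro h0
    apply hne
    refine Set.Subset.antisymm hle fun B hB => ⟨hT.2 B hB, fun f => ?_⟩
    rw [← kernel.lift_ι q f (hz B hB _), h0, comp_zero]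
  refine hT.1.ext_mem _ (ker_se q) hk (hle ⟨hG, fun g => ?_⟩)
  rw [← cancel_epi q, comp_zero]
  by_contra hc
  have := br_iso hft hM hI _ hc
  have : Mono q := mono_of_mono q g
  apply h0
  rw [← cancel_mono q]; simp

lemma perp_mi {M : RepC k Q} (hM : FinDim M) (hI : Indec M) : MeetIrred (perp M) := by
  have hM' : M ∉ perp M := fun h => id_ne hI.1 (h.2 _)
  refine ⟨tors_perp M, ⟨M, hM, hM'⟩, fun T₁ T₂ h1 h2 h => ?_⟩
  by_contra hc
  push Not at hc
  apply hM'
  rw [h]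
  exact ⟨perp_big hft hM hI h1 (by rw [h]; exact Set.inter_subset_left) hc.1,
    perp_big hft hM hI h2 (by rw [h]; exact Set.inter_subset_right) hc.2⟩

variable {N : ℕ} {ψ : RepC k Q → ℕ} (h1 : ∀ X, FinDim X → Indec X → ψ X < N)
  (h3 : ∀ X Y, FinDim X → FinDim Y → Indec X → Indec Y → ψ X = ψ Y → Nonempty (X ≅ Y))
include h1 h3

lemma ji_gen {T : Set (RepC k Q)} (hT : JoinIrred T) :
    ∃ M : RepC k Q, FinDim M ∧ Indec M ∧ T = gen ({M} : Set (RepC k Q)) := by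
  by_contra hc
  push Not at hc
  have key : ∀ m : ℕ, ∃ U : Set (RepC k Q), Tors U ∧ U ⊆ T ∧ T ≠ U ∧
      ∀ X ∈ T, Indec X → ψ X < m → X ∈ U := by
    intro m
    induction m with
    | zero =>
      refine ⟨_, tors_zero, fun X hX => zero_mem hT.1 hX, ?_, fun X _ _ h => by omega⟩
      intro h
      obtain ⟨X, hX, h0⟩ := hT.2.1
      rw [h] at hX
      exact h0 hX
    | succ m ih =>
      obtain ⟨U, hU, hle, hne, hmem⟩ := ih
      by_cases hex : ∃ X ∈ T, Indec X ∧ ψ X = m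
      · obtain ⟨X, hX, hXI, hψ⟩ := hex
        have hXf := hT.1.2 X hX
        have hg := tors_gen hXf (br_E0 hft hXf hXI)
        refine ⟨tjoin k Q U (gen {X}), tors_tjoin hU hg, tjoin_le hT.1 hle (gen_le hT.1 hX), ?_, ?_⟩
        · intro h
          rcases hT.2.2 _ _ hU hg h with h | h
          · exact hne h
          · exact hc X hXf hXI h
        · intro Y hY hYI hlt
          rcases Nat.lt_succ_iff_lt_or_eq.1 hlt with h | h
          · exact le_tjoin_left _ _ (hmem Y hY hYI h)
          · obtain ⟨e⟩ := h3 X Y hXf (hT.1.2 Y hY) hXI hYI (by omega)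
            exact le_tjoin_right _ _ (mem_iso hg e (self_mem_gen X))
      · refine ⟨U, hU, hle, hne, fun X hX hXI hlt => ?_⟩
        rcases Nat.lt_succ_iff_lt_or_eq.1 hlt with h | h
        · exact hmem X hX hXI h
        · exact absurd ⟨X, hX, hXI, h⟩ hex
  obtain ⟨U, hU, hle, hne, hmem⟩ := key N
  apply hne
  refine Set.Subset.antisymm (fun X hX => ?_) hle
  refine mem_of_indec hU (hT.1.2 X hX) fun Y i r hY hYI hir => ?_
  exact hmem Y (hT.1.1.summand_mem X hX Y ⟨i, r, hir⟩) hYI (h1 Y hY hYI)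

lemma mi_perp {T : Set (RepC k Q)} (hT : MeetIrred T) :
    ∃ M : RepC k Q, FinDim M ∧ Indec M ∧ T = perp M := by
  by_contra hc
  push Not at hc
  have key : ∀ m : ℕ, ∃ U : Set (RepC k Q), Tors U ∧ T ⊆ U ∧ T ≠ U ∧
      ∀ Z, FinDim Z → Indec Z → (∀ B ∈ T, HomZero B Z) → ψ Z < m → U ⊆ perp Z := by
    intro m
    induction m with
    | zero =>
      refine ⟨_, tors_fd, hT.1.2, ?_, fun X _ _ _ h => by omega⟩
      intro h
      obtain ⟨X, hX, h0⟩ := hT.2.1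
      apply h0
      rw [h]
      exact hX
    | succ m ih =>
      obtain ⟨U, hU, hle, hne, hmem⟩ := ih
      by_cases hex : ∃ Z, FinDim Z ∧ Indec Z ∧ (∀ B ∈ T, HomZero B Z) ∧ ψ Z = m
      · obtain ⟨Z, hZ, hZI, hB, hψ⟩ := hex
        refine ⟨U ∩ perp Z, tors_inter _ _ hU (tors_perp Z),
          fun B hBT => ⟨hle hBT, hT.1.2 B hBT, hB B hBT⟩, ?_, ?_⟩
        · intro h
          rcases hT.2.2 _ _ hU (tors_perp Z) h with h | h
          · exact hne h
          · exact hc Z hZ hZI h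
        · intro Y hY hYI hYB hlt
          rcases Nat.lt_succ_iff_lt_or_eq.1 hlt with h | h
          · exact Set.inter_subset_left.trans (hmem Y hY hYI hYB h)
          · obtain ⟨e⟩ := h3 Z Y hZ hY hZI hYI (by omega)
            exact fun X hX => mem_perp_iso e hX.2
      · refine ⟨U, hU, hle, hne, fun X hX hXI hXB hlt => ?_⟩
        rcases Nat.lt_succ_iff_lt_or_eq.1 hlt with h | h
        · exact hmem X hX hXI hXB h
        · exact absurd ⟨X, hX, hXI, hXB, h⟩ hex
  obtain ⟨U, hU, hle, hne, hmem⟩ := key N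
  apply hne
  refine Set.Subset.antisymm hle (fun X hX => ?_)
  obtain ⟨G, q, hq, hG, hk, hz⟩ := torsion_quot hT.1 (hU.2 X hX)
  refine hT.1.1.ext_mem _ (ker_se q) hk ?_
  have hq0 : q = 0 := by
    by_contra hq0
    obtain ⟨Y, i, r, hY, hYI, hir, hne⟩ := sum_to hG q hq0
    have hYB : ∀ B ∈ T, HomZero B Y := fun B hB f => by
      rw [← Category.comp_id f, ← hir, ← Category.assoc, hz B hB (f ≫ i), zero_comp]
    exact hne ((hmem Y hY hYI hYB (h1 Y hY hYI) hX).2 _)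
  exact zero_mem hT.1 (IsZero.of_epi_eq_zero q hq0)

end main

lemma splitting_lm {x : Set (RepC k Q)} (hx : Splitting x) : LeftModular x := by
  refine ⟨hx.1, fun y z hy hz hyz => ?_⟩
  have hxz := tors_inter x z hx.1 hz
  have hy' := tors_tjoin hy hxz
  apply Set.Subset.antisymm
  · rintro M ⟨hM, hMz⟩
    obtain ⟨G, q, hq, hG, hk, h0⟩ := torsion_quot hy' (hz.2 M hMz)
    refine hy'.1.ext_mem _ (ker_se q) hk ?_
    have hGz : G ∈ z := hz.1.quot_mem M hMz G q hq
    have hGj : G ∈ tjoin k Q y x := (tors_tjoin hy hx.1).1.quot_mem M hM G q hq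
    have hxG : x ⊆ perp G := by
      intro B hB
      refine ⟨hx.1.2 B hB, fun f => ?_⟩
      by_contra hf
      obtain ⟨Y, i, r, hY, hYI, hir, hne⟩ := sum_to hG f hf
      rcases hx.2 Y hY hYI with h | h
      · have hYz : Y ∈ z := hz.1.summand_mem G hGz Y ⟨i, r, hir⟩
        have hi := h0 Y (le_tjoin_right _ _ ⟨h, hYz⟩) i
        apply id_ne hYI.1
        rw [← hir, hi, zero_comp]
      · exact hne (h B hB _)
    have hyG : y ⊆ perp G := fun B hB => ⟨hy.2 B hB, h0 B (le_tjoin_left _ _ hB)⟩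
    have := (tjoin_le (tors_perp G) hyG hxG hGj).2 (𝟙 G)
    exact zero_mem hy' ((IsZero.iff_id_eq_zero G).2 this)
  · apply Set.subset_inter
    · exact tjoin_le (tors_tjoin hy hx.1) (le_tjoin_left _ _)
        (Set.inter_subset_left.trans (le_tjoin_right _ _))
    · exact tjoin_le hz hyz Set.inter_subset_right

def cc (ψ : RepC k Q → ℕ) (i : ℕ) : Set (RepC k Q) :=
  {X | FinDim X ∧ ∀ Y, FinDim Y → Indec Y → i ≤ ψ Y → HomZero X Y}

lemma tors_cc (ψ : RepC k Q → ℕ) (i : ℕ) : Tors (cc ψ i) := by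
  have : cc ψ i = ⋂₀ (insert {X : RepC k Q | FinDim X}
      {U | ∃ Y, FinDim Y ∧ Indec Y ∧ i ≤ ψ Y ∧ U = perp Y}) := by
    apply Set.Subset.antisymm
    · rintro X ⟨hX, h⟩ U (rfl | ⟨Y, a, b, c, rfl⟩)
      · exact hX
      · exact ⟨hX, h Y a b c⟩
    · intro X hX
      exact ⟨hX _ (Set.mem_insert _ _), fun Y a b c =>
        (hX _ (Set.mem_insert_of_mem _ ⟨Y, a, b, c, rfl⟩)).2⟩
  rw [this]
  refine tors_sInter ?_ ⟨_, Set.mem_insert _ _⟩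
  rintro U (rfl | ⟨Y, a, b, c, rfl⟩)
  · exact tors_fd
  · exact tors_perp Y

lemma cc_mono (ψ : RepC k Q → ℕ) {i j : ℕ} (h : i ≤ j) : cc ψ i ⊆ cc ψ j :=
  fun _ hX => ⟨hX.1, fun Y a b c => hX.2 Y a b (h.trans c)⟩

section psi
variable {N : ℕ} {ψ : RepC k Q → ℕ} (h1 : ∀ X, FinDim X → Indec X → ψ X < N)
  (h2 : ∀ i < N, ∃ X, FinDim X ∧ Indec X ∧ ψ X = i)
  (h3 : ∀ X Y, FinDim X → FinDim Y → Indec X → Indec Y → ψ X = ψ Y → Nonempty (X ≅ Y))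
  (h4 : ∀ X Y (f : X ⟶ Y), FinDim X → FinDim Y → Indec X → Indec Y → f ≠ 0 → ψ Y ≤ ψ X)

include h4 in
lemma mem_cc {X : RepC k Q} (hX : FinDim X) (hI : Indec X) (i : ℕ) : X ∈ cc ψ i ↔ ψ X < i := by
  constructor
  · intro h
    by_contra hc
    exact id_ne hI.1 (h.2 X hX hI (by omega) _)
  · intro h
    refine ⟨hX, fun Y hY hYI hi f => ?_⟩
    by_contra hf
    have := h4 X Y f hX hY hI hYI hf
    omega

include h4 in
lemma split_cc (i : ℕ) : Splitting (cc ψ i) := by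
  refine ⟨tors_cc ψ i, fun M hM hI => ?_⟩
  rw [mem_cc h4 hM hI]
  by_cases h : ψ M < i
  · exact Or.inl h
  · exact Or.inr fun Y hY => hY.2 M hM hI (by omega)

include h2 h4 in
lemma cc_ssub {i j : ℕ} (h : i < j) (hj : j ≤ N) : cc ψ i ⊂ cc ψ j := by
  refine (Set.ssubset_iff_of_subset (cc_mono ψ h.le)).2 ?_
  obtain ⟨X, hX, hI, hψ⟩ := h2 i (by omega)
  exact ⟨X, (mem_cc h4 hX hI j).2 (by omega), fun hc => by
    have := (mem_cc h4 hX hI i).1 hc; omega⟩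

include h2 h4 in
lemma cc_chain : TorsChain N (fun i : Fin (N + 1) => cc ψ i) :=
  ⟨fun i => tors_cc ψ i, fun i j hij => cc_ssub h2 h4 hij (by omega)⟩

include h1 h2 h3 h4 in
lemma cc_max : MaxTorsChain N (fun i : Fin (N + 1) => cc ψ i) := by
  refine ⟨cc_chain h2 h4, ?_, ?_, ?_⟩
  · apply Set.Subset.antisymm
    · rintro X ⟨hX, h⟩
      by_contra h0
      obtain ⟨Y, i, r, hY, hYI, hir, hne⟩ := sum_to hX (𝟙 X) (id_ne h0)
      exact hne (h Y hY hYI (by simp) _)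
    · intro X hX
      exact ⟨fd_zero hX, fun Y _ _ _ f => IsZero.eq_of_src hX _ _⟩
  · apply Set.Subset.antisymm
    · exact fun X hX => hX.1
    · intro X hX
      refine ⟨hX, fun Y a b c => ?_⟩
      have := h1 Y a b
      simp at c
      omega
  · intro i T hT hle hge
    simp only [Fin.val_castSucc, Fin.val_succ] at hle hge ⊢
    obtain ⟨Z, hZ, hZI, hψ⟩ := h2 i i.2
    by_cases hZT : Z ∈ T
    · right
      refine Set.Subset.antisymm hge fun X hX => ?_
      refine mem_of_indec hT hX.1 fun Y a r hY hYI hir => ?_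
      have := (mem_cc h4 hY hYI _).1 ((tors_cc ψ (i + 1)).1.summand_mem X hX Y ⟨a, r, hir⟩)
      rcases Nat.lt_succ_iff_lt_or_eq.1 this with h | h
      · exact hle ((mem_cc h4 hY hYI _).2 h)
      · obtain ⟨e⟩ := h3 Z Y hZ hY hZI hYI (by omega)
        exact mem_iso hT e hZT
    · left
      refine Set.Subset.antisymm (fun X hX => ?_) hle
      refine mem_of_indec (tors_cc ψ i) (hT.2 X hX) fun Y a r hY hYI hir => ?_
      have hYT := hT.1.summand_mem X hX Y ⟨a, r, hir⟩
      have := (mem_cc h4 hY hYI _).1 (hge hYT)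
      rcases Nat.lt_succ_iff_lt_or_eq.1 this with h | h
      · exact (mem_cc h4 hY hYI _).2 h
      · obtain ⟨e⟩ := h3 Y Z hY hZ hYI hZI (by omega)
        exact absurd (mem_iso hT e hYT) hZT

include h1 h3 in
lemma chain_le {M : ℕ} {c : Fin (M + 1) → Set (RepC k Q)} (hc : TorsChain M c) : M ≤ N := by
  have key : ∀ i : Fin M, ∃ Y, FinDim Y ∧ Indec Y ∧ Y ∈ c i.succ ∧ Y ∉ c i.castSucc := by
    intro i
    by_contra hn
    push Not at hn
    have hs := hc.2 i.castSucc i.succ (Fin.castSucc_lt_succ)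
    apply hs.2
    intro X hX
    refine mem_of_indec (hc.1 _) ((hc.1 _).2 X hX) fun Y a r hY hYI hir => ?_
    exact hn Y hY hYI ((hc.1 _).1.summand_mem X hX Y ⟨a, r, hir⟩)
  choose Y hY hYI hm hn using key
  have hlt : ∀ i j, i < j → ψ (Y i) ≠ ψ (Y j) := by
    intro i j hij h
    obtain ⟨e⟩ := h3 _ _ (hY i) (hY j) (hYI i) (hYI j) h
    apply hn j
    refine mem_iso (hc.1 _) e ?_
    have hle : i.succ ≤ j.castSucc := by
      rw [Fin.le_def]; simp; omega
    rcases hle.eq_or_lt with h | h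
    · rw [← h]; exact hm i
    · exact (hc.2 _ _ h).1 (hm i)
  have hinj : Function.Injective (fun i : Fin M => (⟨ψ (Y i), h1 _ (hY i) (hYI i)⟩ : Fin N)) := by
    intro i j h
    have h' : ψ (Y i) = ψ (Y j) := congrArg Fin.val h
    rcases lt_trichotomy i j with h | h | h
    · exact absurd h' (hlt _ _ h)
    · exact h
    · exact absurd h'.symm (hlt _ _ h)
  simpa using Fintype.card_le_of_injective _ hinj

include h1 h2 h3 in
lemma card_irr (P : Set (RepC k Q) → Prop) (F : RepC k Q → Set (RepC k Q))
    (ha : ∀ M, FinDim M → Indec M → P (F M))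
    (hb : ∀ T, P T → ∃ M, FinDim M ∧ Indec M ∧ T = F M)
    (hi : ∀ M M', FinDim M → Indec M → FinDim M' → Indec M' → F M = F M' → ψ M = ψ M')
    (hiso : ∀ M M', FinDim M → Indec M → FinDim M' → Indec M' → (M ≅ M') → F M = F M') :
    Nat.card {T // P T} = N := by
  choose! Z hZ hZI hψ using h2
  let g : Fin N → {T // P T} := fun i => ⟨F (Z i), ha _ (hZ i i.2) (hZI i i.2)⟩
  have hg : Function.Bijective g := by
    constructor
    · intro i j h
      have := hi _ _ (hZ i i.2) (hZI i i.2) (hZ j j.2) (hZI j j.2) (congrArg Subtype.val h)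
      rw [hψ i i.2, hψ j j.2] at this
      exact Fin.ext this
    · rintro ⟨T, hT⟩
      obtain ⟨M, hM, hI, rfl⟩ := hb T hT
      have hlt := h1 M hM hI
      refine ⟨⟨ψ M, hlt⟩, Subtype.ext ?_⟩
      obtain ⟨e⟩ := h3 _ _ (hZ _ hlt) hM (hZI _ hlt) hI (hψ _ hlt)
      exact hiso _ _ (hZ _ hlt) (hZI _ hlt) hM hI e
  rw [← Nat.card_eq_of_bijective g hg, Nat.card_fin]

end psi

end Lat

/-- For `Q` an orientation of a Dynkin diagram, the Cambrian
lattice `C_Q` — the lattice of torsion classes of `rep Q` ordered by inclusion — is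
trim: it is extremal (the number of join-irreducibles and of meet-irreducibles both
equal the length of the longest chain) and left modular (it has a maximal chain of
left modular elements).  Moreover its join-irreducibles are exactly the principal
torsion classes `Gen(M_α)` for `M_α` indecomposable, meets are given by intersection,
and the splitting torsion classes form a maximal chain of left modular elements. -/
theorem statement19 (k : Type) [Field k] [IsAlgClosed k] (Q : FinQuiver)
    (hft : FiniteType Q) :
    (∀ T₁ T₂ : Set (RepC k Q), Tors T₁ → Tors T₂ → Tors (T₁ ∩ T₂)) ∧
    (∀ T : Set (RepC k Q), JoinIrred T ↔
      ∃ M : RepC k Q, FinDim M ∧ Indec M ∧ T = gen ({M} : Set (RepC k Q))) ∧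
    (∃ N : ℕ,
      ((∃ c : Fin (N + 1) → Set (RepC k Q), TorsChain N c) ∧
        ∀ M : ℕ, (∃ c : Fin (M + 1) → Set (RepC k Q), TorsChain M c) → M ≤ N) ∧
      Nat.card { T : Set (RepC k Q) // JoinIrred T } = N ∧
      Nat.card { T : Set (RepC k Q) // MeetIrred T } = N ∧
      ∃ c : Fin (N + 1) → Set (RepC k Q), MaxTorsChain N c ∧
        ∀ i, Splitting (c i) ∧ LeftModular (c i)) ∧
    (∀ T : Set (RepC k Q), Splitting T → LeftModular T) := by
  obtain ⟨N, ψ, h1, h2, h3, h4⟩ := exists_psi k Q hft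
  refine ⟨tors_inter, fun T => ⟨ji_gen hft h1 h3, ?_⟩, ⟨N, ⟨⟨_, cc_chain h2 h4⟩, ?_⟩, ?_, ?_,
    ⟨_, cc_max h1 h2 h3 h4, fun i => ⟨split_cc h4 i, splitting_lm (split_cc h4 i)⟩⟩⟩,
    fun T hT => splitting_lm hT⟩
  · rintro ⟨M, hM, hI, rfl⟩
    exact gen_ji hft hM hI
  · rintro M ⟨c, hc⟩
    exact chain_le h1 h3 hc
  · refine card_irr h1 h2 h3 _ (fun M => gen {M}) (fun M => gen_ji hft)
      (fun T hT => ji_gen hft h1 h3 hT) ?_ ?_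
    · intro M M' hM hI hM' hI' h
      obtain ⟨f, hf⟩ := hom_of_mem_gen hM (by rw [h]; exact self_mem_gen M') hI'.1
      obtain ⟨g, hg⟩ := hom_of_mem_gen hM' (by rw [← h]; exact self_mem_gen M) hI.1
      exact le_antisymm (h4 _ _ g hM' hM hI' hI hg) (h4 _ _ f hM hM' hI hI' hf)
    · intro M M' hM hI hM' hI' e
      have a1 := tors_gen hM (br_E0 hft hM hI)
      have a2 := tors_gen hM' (br_E0 hft hM' hI')
      exact Set.Subset.antisymm (gen_le a2 (mem_iso a2 e.symm (self_mem_gen M')))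
        (gen_le a1 (mem_iso a1 e (self_mem_gen M)))
  · refine card_irr h1 h2 h3 _ (fun M => perp M) (fun M => perp_mi hft)
      (fun T hT => mi_perp hft h1 h3 hT) ?_ ?_
    · have key : ∀ M M' : RepC k Q, FinDim M → Indec M → FinDim M' → Indec M' → perp M = perp M' →
          ψ M' ≤ ψ M := by
        intro M M' hM hI hM' hI' h
        by_contra hc
        have : M ∈ perp M' := ⟨hM, fun f => by
          by_contra hf
          exact hc (h4 _ _ f hM hM' hI hI' hf)⟩
        rw [← h] at this
        exact id_ne hI.1 (this.2 _)
      intro M M' hM hI hM' hI' h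
      exact le_antisymm (key _ _ hM' hI' hM hI h.symm) (key _ _ hM hI hM' hI' h)
    · intro M M' hM hI hM' hI' e
      exact Set.Subset.antisymm (fun X hX => mem_perp_iso e hX) (fun X hX => mem_perp_iso e.symm hX)


end Statement19
end NCPaper
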